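/- Let K_x ⊂ ℝ^n and K_yz ⊂ ℝ^{m+p} be compact, and assume K = K_x × K_yz ⊂ ℝ^{n+m+p} has nonempty interior. Suppose there exists a scalar N ∈ ℝ such that N − ‖(Y,Z)‖² ∈ Q(h). If f ∈ ℝ[X,Y] + ℝ[Y,Z] and f(x,y,z) > 0 for all (x,y,z) ∈ K, then f ∈ Σ²_xy + P(g) + Q(h), i.e. f = κ + σ + ψ for some sum of squares κ ∈ Σ²_xy, some σ ∈ P(g) and some ψ ∈ Q(h). -/

import Mathlib

open MvPolynomial

/-- A polynomial is a sum of squares. -/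
def IsSOS {ι : Type*} (q : MvPolynomial ι ℝ) : Prop :=
  ∃ (k : ℕ) (s : Fin k → MvPolynomial ι ℝ), q = ∑ i, (s i) ^ 2

/-- Membership in the preordering generated by a finite family `g`:
`σ = Σ_{J ⊆ I} σ_J ∏_{j ∈ J} g_j` with each `σ_J` a sum of squares. -/
def InPreordering {ι κ : Type*} [Fintype κ] [DecidableEq κ]
    (g : κ → MvPolynomial ι ℝ) (σ : MvPolynomial ι ℝ) : Prop :=
  ∃ c : Finset κ → MvPolynomial ι ℝ,
    (∀ J, IsSOS (c J)) ∧ σ = ∑ J : Finset κ, c J * ∏ j ∈ J, g j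

/-- Membership in the quadratic module generated by a finite family `g`:
`σ = σ₀ + Σ_j σ_j g_j` with `σ₀` and each `σ_j` sums of squares. -/
def InQuadraticModule {ι κ : Type*} [Fintype κ]
    (g : κ → MvPolynomial ι ℝ) (σ : MvPolynomial ι ℝ) : Prop :=
  ∃ (c₀ : MvPolynomial ι ℝ) (c : κ → MvPolynomial ι ℝ),
    IsSOS c₀ ∧ (∀ j, IsSOS (c j)) ∧ σ = c₀ + ∑ j, c j * g j

section
open MvPolynomial
namespace Polynomial.CP
set_option linter.unusedSectionVars false
open scoped Polynomial

/-- Intermediate value property for polynomials over an ordered field. -/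
def PolyIVT (S : Type*) [Field S] [LinearOrder S] : Prop :=
  ∀ (p : S[X]) (a b : S), a ≤ b → p.eval a ≤ 0 → 0 ≤ p.eval b →
    ∃ c, a ≤ c ∧ c ≤ b ∧ p.eval c = 0

theorem PolyIVT.mul_neg {S : Type*} [Field S] [LinearOrder S] [IsStrictOrderedRing S]
    (h : PolyIVT S) (p : S[X]) (a b : S) (hab : a ≤ b) (hp : p.eval a * p.eval b < 0) :
    ∃ c, a < c ∧ c < b ∧ p.eval c = 0 := by
  have key : ∃ c, a ≤ c ∧ c ≤ b ∧ p.eval c = 0 := by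
    rcases mul_neg_iff.mp hp with ⟨h1, h2⟩ | ⟨h1, h2⟩
    · obtain ⟨c, hc1, hc2, hc3⟩ := h (-p) a b hab (by simpa using h1.le) (by simpa using h2.le)
      exact ⟨c, hc1, hc2, by simpa using hc3⟩
    · exact h p a b hab h1.le h2.le
  obtain ⟨c, hc1, hc2, hc3⟩ := key
  refine ⟨c, lt_of_le_of_ne hc1 ?_, lt_of_le_of_ne hc2 ?_, hc3⟩
  · rintro rfl; simp [hc3] at hp
  · rintro rfl; simp [hc3] at hp

section Field
variable {S : Type*} [Field S] [LinearOrder S] [IsStrictOrderedRing S]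

theorem factor_root (p : S[X]) (hp : p ≠ 0) (a : S) (ha : p.eval a = 0) :
    ∃ (m : ℕ) (q : S[X]), p = (X - C a) ^ (m + 1) * q ∧ q.eval a ≠ 0 := by
  obtain ⟨q, hq, hq2⟩ := exists_eq_pow_rootMultiplicity_mul_and_not_dvd p hp a
  have hm : 0 < p.rootMultiplicity a := (rootMultiplicity_pos hp).mpr ha
  obtain ⟨m, hm⟩ := Nat.exists_eq_succ_of_ne_zero hm.ne'
  rw [hm] at hq
  refine ⟨m, q, hq, fun h0 => hq2 (dvd_iff_isRoot.mpr h0)⟩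

theorem rolle_adj (h : PolyIVT S) (p : S[X]) (hp : p ≠ 0) (a b : S) (hab : a < b)
    (ha : p.eval a = 0) (hb : p.eval b = 0) (hno : ∀ c, a < c → c < b → p.eval c ≠ 0) :
    ∃ c, a < c ∧ c < b ∧ (derivative p).eval c = 0 := by
  obtain ⟨m, q, rfl, hqa⟩ := factor_root p hp a ha
  have hab' : (b - a) ≠ 0 := sub_ne_zero.mpr hab.ne'
  have hq0 : q ≠ 0 := by rintro rfl; simp at hqa
  have hqb : q.eval b = 0 := by simpa [hab'] using hb
  obtain ⟨n, g, rfl, hgb⟩ := factor_root q hq0 b hqb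
  have hga : g.eval a ≠ 0 := by
    intro h0; apply hqa; simp [h0]
  have hgg : 0 < g.eval a * g.eval b := by
    rcases lt_or_gt_of_ne (mul_ne_zero hga hgb) with h1 | h1
    · obtain ⟨c, h2, h3, h4⟩ := h.mul_neg g a b hab.le h1
      exact absurd (by simp [h4]) (hno c h2 h3)
    · exact h1
  let r : S[X] := C ((m : S) + 1) * (X - C b) * g + C ((n : S) + 1) * (X - C a) * g
    + (X - C a) * (X - C b) * derivative g
  have hd : derivative ((X - C a) ^ (m + 1) * ((X - C b) ^ (n + 1) * g)) =
      (X - C a) ^ m * (X - C b) ^ n * r := by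
    simp only [r, derivative_mul, derivative_X_sub_C_pow, Nat.add_sub_cancel]
    push_cast
    simp only [map_add, map_natCast, map_one]
    ring
  have hra : r.eval a = ((m : S) + 1) * (a - b) * g.eval a := by simp [r]
  have hrb : r.eval b = ((n : S) + 1) * (b - a) * g.eval b := by simp [r]
  have hneg : r.eval a * r.eval b < 0 := by
    rw [hra, hrb]
    have h1 : (0 : S) < (m : S) + 1 := by positivity
    have h2 : (0 : S) < (n : S) + 1 := by positivity
    have h3 : 0 < b - a := sub_pos.mpr hab
    have : ((m : S) + 1) * (a - b) * eval a g * (((n : S) + 1) * (b - a) * eval b g) =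
      -((((m : S) + 1) * ((n : S) + 1)) * ((b - a) * (b - a)) * (eval a g * eval b g)) := by ring
    rw [this]
    have := mul_pos (mul_pos (mul_pos h1 h2) (mul_pos h3 h3)) hgg
    linarith
  obtain ⟨c, h1, h2, h3⟩ := h.mul_neg r a b hab.le hneg
  exact ⟨c, h1, h2, by rw [hd]; simp [h3]⟩

theorem rolle (h : PolyIVT S) (p : S[X]) (a b : S) (hab : a < b)
    (ha : p.eval a = 0) (hb : p.eval b = 0) :
    ∃ c, a < c ∧ c < b ∧ (derivative p).eval c = 0 := by
  by_cases hp : p = 0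
  · obtain ⟨c, h1, h2⟩ := exists_between hab
    exact ⟨c, h1, h2, by simp [hp]⟩
  let F := p.roots.toFinset.filter (fun c => a < c)
  have hF : F.Nonempty := ⟨b, by simp [F, hp, hab, hb]⟩
  have hmem := F.min'_mem hF
  set b' := F.min' hF
  have hb' : (p ≠ 0 ∧ p.eval b' = 0) ∧ a < b' := by simpa [F] using hmem
  obtain ⟨c, h1, h2, h3⟩ := rolle_adj h p hp a b' hb'.2 ha hb'.1.2 (by
    intro c h1 h2 h3
    have : b' ≤ c := F.min'_le c (by simp [F, hp, h1, h3])
    exact absurd h2 (not_lt.mpr this))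
  have : b' ≤ b := F.min'_le b (by simp [F, hp, hab, hb])
  exact ⟨c, h1, h2.trans_le this, h3⟩

theorem mvt (h : PolyIVT S) (p : S[X]) (a b : S) (hab : a < b) :
    ∃ c, a < c ∧ c < b ∧ p.eval b - p.eval a = (derivative p).eval c * (b - a) := by
  have hab' : (b - a) ≠ 0 := sub_ne_zero.mpr hab.ne'
  obtain ⟨c, h1, h2, h3⟩ := rolle h
    (C (b - a) * (p - C (p.eval a)) - C (p.eval b - p.eval a) * (X - C a)) a b hab
    (by simp) (by simp; ring)
  refine ⟨c, h1, h2, ?_⟩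
  simp at h3
  linarith

theorem sign_at_top (p : S[X]) (hp : p ≠ 0) :
    ∃ B c : S, 0 < B ∧ 0 < c ∧ ∀ y, B ≤ y → c ≤ p.eval y * p.leadingCoeff := by
  induction hd : p.natDegree generalizing p with
  | zero =>
    refine ⟨1, p.leadingCoeff * p.leadingCoeff, one_pos,
      mul_self_pos.mpr (leadingCoeff_ne_zero.mpr hp), fun y _ => ?_⟩
    rw [eq_C_of_natDegree_eq_zero hd]; simp
  | succ n ih =>
    have hdd : p.divX.natDegree = n := by rw [natDegree_divX_eq_natDegree_tsub_one, hd]; rfl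
    have hlc : p.divX.leadingCoeff = p.leadingCoeff := by
      rw [leadingCoeff, leadingCoeff, hdd, hd, coeff_divX]
    have hp0 : p.divX ≠ 0 := by
      rw [← leadingCoeff_ne_zero, hlc]; exact leadingCoeff_ne_zero.mpr hp
    obtain ⟨B, c, hB, hc, H⟩ := ih p.divX hp0 hdd
    refine ⟨B + 1 + |p.coeff 0 * p.leadingCoeff| / c, c, by positivity, hc, fun y hy => ?_⟩
    have e : 0 ≤ |p.coeff 0 * p.leadingCoeff| / c := by positivity
    have h1 := H y (by linarith)
    rw [hlc] at h1
    have h2 : p.eval y = y * p.divX.eval y + p.coeff 0 := by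
      have h5 := congrArg (eval y) (X_mul_divX_add p)
      rw [eval_add, eval_mul, eval_X, eval_C] at h5
      exact h5.symm
    have h3 : (1 + |p.coeff 0 * p.leadingCoeff| / c) * c ≤ y * (p.divX.eval y * p.leadingCoeff) := by
      apply mul_le_mul (by linarith) h1 hc.le (by linarith)
    rw [add_mul, div_mul_cancel₀ _ hc.ne'] at h3
    have h4 := neg_abs_le (p.coeff 0 * p.leadingCoeff)
    rw [h2]; linarith

theorem sign_at_top' (p : S[X]) (hp : p ≠ 0) :
    ∃ B : S, ∀ y, B ≤ y → SignType.sign (p.eval y) = SignType.sign p.leadingCoeff := by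
  obtain ⟨B, c, _, hc, H⟩ := sign_at_top p hp
  refine ⟨B, fun y hy => ?_⟩
  have := hc.trans_le (H y hy)
  rcases mul_pos_iff.mp this with ⟨h1, h2⟩ | ⟨h1, h2⟩
  · rw [sign_pos h1, sign_pos h2]
  · rw [sign_neg h1, sign_neg h2]

theorem sign_at_bot' (p : S[X]) (hp : p ≠ 0) :
    ∃ B : S, ∀ y, B ≤ y → SignType.sign (p.eval (-y)) =
      SignType.sign ((-1) ^ p.natDegree * p.leadingCoeff) := by
  have h0 : p.comp (-X) ≠ 0 := by
    intro h
    have := congrArg (fun q => q.comp (-X)) h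
    simp [comp_assoc] at this
    exact hp this
  obtain ⟨B, H⟩ := sign_at_top' _ h0
  refine ⟨B, fun y hy => ?_⟩
  have := H y hy
  rw [comp_neg_X_leadingCoeff_eq] at this
  simpa using this

end Field
end Polynomial.CP
end

section
open MvPolynomial
namespace Polynomial.CP
open scoped Polynomial
set_option linter.unusedSectionVars false

section Table
variable {S S' : Type*} [Field S] [LinearOrder S] [IsStrictOrderedRing S]
  [Field S'] [LinearOrder S'] [IsStrictOrderedRing S']

/-- `y` and `y'` have the same position relative to the matched points in `D`. -/
def Rel (D : Finset (S × S')) (y : S) (y' : S') : Prop :=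
  ∀ d ∈ D, (y < d.1 ↔ y' < d.2) ∧ (d.1 < y ↔ d.2 < y')

theorem Rel.eq_iff {D : Finset (S × S')} {y : S} {y' : S'} (h : Rel D y y') {d : S × S'}
    (hd : d ∈ D) : y = d.1 ↔ y' = d.2 := by
  have := h d hd
  constructor
  · rintro rfl
    exact le_antisymm (not_lt.mp fun h1 => lt_irrefl _ (this.2.mpr h1))
      (not_lt.mp fun h1 => lt_irrefl _ (this.1.mpr h1))
  · rintro rfl
    exact le_antisymm (not_lt.mp fun h1 => lt_irrefl _ (this.2.mp h1))
      (not_lt.mp fun h1 => lt_irrefl _ (this.1.mp h1))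

theorem neighbors (D : Finset (S × S')) (y : S) (hlo : ∃ d ∈ D, d.1 < y) (hhi : ∃ d ∈ D, y < d.1)
    (hne : ∀ d ∈ D, y ≠ d.1) :
    ∃ d ∈ D, ∃ e ∈ D, d.1 < y ∧ y < e.1 ∧ ∀ c ∈ D, c.1 ≤ d.1 ∨ e.1 ≤ c.1 := by
  obtain ⟨d0, hd0, hd0'⟩ := hlo
  obtain ⟨e0, he0, he0'⟩ := hhi
  obtain ⟨d, hd, hdm⟩ := (D.filter (fun d => d.1 < y)).exists_max_image Prod.fst
    ⟨d0, by simp [hd0, hd0']⟩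
  obtain ⟨e, he, hem⟩ := (D.filter (fun d => y < d.1)).exists_min_image Prod.fst
    ⟨e0, by simp [he0, he0']⟩
  rw [Finset.mem_filter] at hd he
  refine ⟨d, hd.1, e, he.1, hd.2, he.2, fun c hc => ?_⟩
  rcases lt_or_gt_of_ne (hne c hc) with h | h
  · exact .inr (hem c (by simp [hc, h]))
  · exact .inl (hdm c (by simp [hc, h]))

/-- A partial sign table matching. -/
structure Good (lo hi : S) (lo' hi' : S') (T s : Set (S[X] × S'[X])) (D : Finset (S × S')) :
    Prop where
  mlo : (lo, lo') ∈ D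
  mhi : (hi, hi') ∈ D
  range : ∀ d ∈ D, lo ≤ d.1 ∧ d.1 ≤ hi
  mono : ∀ d ∈ D, Rel D d.1 d.2
  signT : ∀ d ∈ D, ∀ F ∈ T, SignType.sign (F.1.eval d.1) = SignType.sign (F.2.eval d.2)
  signs : ∀ y y', lo ≤ y → y ≤ hi → Rel D y y' → ∀ F ∈ s,
    SignType.sign (F.1.eval y) = SignType.sign (F.2.eval y')

variable {lo hi : S} {lo' hi' : S'} {T s : Set (S[X] × S'[X])} {D : Finset (S × S')}

theorem Rel.swap {y : S} {y' : S'} (h : Rel D y y') : Rel (D.image Prod.swap) y' y := by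
  intro d hd
  obtain ⟨e, he, rfl⟩ := Finset.mem_image.mp hd
  exact ⟨(h e he).1.symm, (h e he).2.symm⟩

theorem Rel.of_swap {y : S} {y' : S'} (h : Rel (D.image Prod.swap) y' y) : Rel D y y' := by
  intro d hd
  have := h d.swap (Finset.mem_image_of_mem _ hd)
  exact ⟨this.1.symm, this.2.symm⟩

theorem Good.range_of_rel (G : Good lo hi lo' hi' T s D) {y : S} {y' : S'} (h : Rel D y y') :
    (lo ≤ y ↔ lo' ≤ y') ∧ (y ≤ hi ↔ y' ≤ hi') := by
  constructor
  · rw [← not_lt, ← not_lt, (h _ G.mlo).1]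
  · rw [← not_lt, ← not_lt, (h _ G.mhi).2]

theorem Good.swap (G : Good lo hi lo' hi' T s D) :
    Good lo' hi' lo hi (Prod.swap '' T) (Prod.swap '' s) (D.image Prod.swap) where
  mlo := Finset.mem_image.mpr ⟨_, G.mlo, rfl⟩
  mhi := Finset.mem_image.mpr ⟨_, G.mhi, rfl⟩
  range := by
    intro d hd
    obtain ⟨e, he, rfl⟩ := Finset.mem_image.mp hd
    have := G.range_of_rel (G.mono e he)
    exact ⟨this.1.mp (G.range e he).1, this.2.mp (G.range e he).2⟩
  mono := by
    intro d hd
    obtain ⟨e, he, rfl⟩ := Finset.mem_image.mp hd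
    exact (G.mono e he).swap
  signT := by
    intro d hd F hF
    obtain ⟨e, he, rfl⟩ := Finset.mem_image.mp hd
    obtain ⟨F, hF, rfl⟩ := hF
    exact (G.signT e he F hF).symm
  signs := by
    rintro y y' h1 h2 h _ ⟨F, hF, rfl⟩
    have h' := h.of_swap
    have := G.range_of_rel h'
    exact (G.signs y' y (this.1.mpr h1) (this.2.mpr h2) h' F hF).symm

theorem Good.gap_rel (G : Good lo hi lo' hi' T s D) {d e : S × S'} (hd : d ∈ D) (he : e ∈ D)
    (hadj : ∀ c ∈ D, c.1 ≤ d.1 ∨ e.1 ≤ c.1) {w : S} {w' : S'} (h1 : d.1 < w) (h2 : w < e.1)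
    (h1' : d.2 < w') (h2' : w' < e.2) : Rel D w w' := by
  intro c hc
  rcases hadj c hc with h | h
  · have hle : c.2 ≤ d.2 := by
      rw [← not_lt, ← (G.mono d hd c hc).1, not_lt]; exact h
    exact ⟨⟨fun h3 => absurd (h3.trans_le h) h1.not_gt,
      fun h3 => absurd (h3.trans_le hle) h1'.not_gt⟩,
      ⟨fun _ => hle.trans_lt h1', fun _ => h.trans_lt h1⟩⟩
  · have hle : e.2 ≤ c.2 := by
      rw [← not_lt, ← (G.mono e he c hc).2, not_lt]; exact h
    exact ⟨⟨fun _ => h2'.trans_le hle, fun _ => h2.trans_le h⟩,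
      ⟨fun h3 => absurd (h.trans_lt h3) h2.not_gt, fun h3 => absurd (hle.trans_lt h3) h2'.not_gt⟩⟩

theorem Good.lift (G : Good lo hi lo' hi' T s D) {y : S} (h1 : lo ≤ y) (h2 : y ≤ hi) :
    ∃ y', Rel D y y' := by
  by_cases h : ∃ d ∈ D, y = d.1
  · obtain ⟨d, hd, rfl⟩ := h
    exact ⟨d.2, G.mono d hd⟩
  · push Not at h
    obtain ⟨d, hd, e, he, h3, h4, hadj⟩ := neighbors D y
      ⟨_, G.mlo, lt_of_le_of_ne h1 (h _ G.mlo).symm⟩ ⟨_, G.mhi, lt_of_le_of_ne h2 (h _ G.mhi)⟩ h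
    have : d.2 < e.2 := ((G.mono d hd e he).1).mp (h3.trans h4)
    obtain ⟨y', h5, h6⟩ := exists_between this
    exact ⟨y', G.gap_rel hd he hadj h3 h4 h5 h6⟩

theorem Good.gap_const (G : Good lo hi lo' hi' T s D) {d e : S × S'} (hd : d ∈ D) (he : e ∈ D)
    (hadj : ∀ c ∈ D, c.1 ≤ d.1 ∨ e.1 ≤ c.1) {v w : S} (h1 : d.1 < v) (h2 : v < e.1)
    (h3 : d.1 < w) (h4 : w < e.1) {q : S[X] × S'[X]} (hq : q ∈ s) :
    SignType.sign (q.1.eval v) = SignType.sign (q.1.eval w) := by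
  have : d.2 < e.2 := ((G.mono d hd e he).1).mp (h1.trans h2)
  obtain ⟨y', h5, h6⟩ := exists_between this
  have r1 := G.range d hd
  have r2 := G.range e he
  rw [G.signs v y' (r1.1.trans h1.le) (h2.le.trans r2.2) (G.gap_rel hd he hadj h1 h2 h5 h6) q hq,
    G.signs w y' (r1.1.trans h3.le) (h4.le.trans r2.2) (G.gap_rel hd he hadj h3 h4 h5 h6) q hq]

theorem Good.gap_ne (G : Good lo hi lo' hi' T s D) {d e : S × S'} (hd : d ∈ D) (he : e ∈ D)
    (hadj : ∀ c ∈ D, c.1 ≤ d.1 ∨ e.1 ≤ c.1) {v : S} (h1 : d.1 < v) (h2 : v < e.1)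
    {q : S[X] × S'[X]} (hq : q ∈ s) (hq0 : q.1 ≠ 0) : q.1.eval v ≠ 0 := by
  intro h0
  apply hq0
  apply eq_zero_of_infinite_isRoot
  apply (Set.Ioo_infinite (h1.trans h2)).mono
  intro w hw
  have := G.gap_const hd he hadj h1 h2 hw.1 hw.2 hq
  rw [h0, sign_zero] at this
  exact sign_eq_zero_iff.mp this.symm

theorem Good.neighbors (G : Good lo hi lo' hi' T s D) {y : S} (h1 : lo ≤ y) (h2 : y ≤ hi)
    (h : ∀ d ∈ D, y ≠ d.1) :
    ∃ d ∈ D, ∃ e ∈ D, d.1 < y ∧ y < e.1 ∧ ∀ c ∈ D, c.1 ≤ d.1 ∨ e.1 ≤ c.1 :=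
  CP.neighbors D y
      ⟨_, G.mlo, lt_of_le_of_ne h1 (h _ G.mlo).symm⟩ ⟨_, G.mhi, lt_of_le_of_ne h2 (h _ G.mhi)⟩ h

theorem Good.unique (hS : PolyIVT S) (G : Good lo hi lo' hi' T s D) {f q : S[X] × S'[X]}
    (hq : q ∈ s) (hqf : q.1 = derivative f.1) (hq0 : q.1 ≠ 0) {z₁ z₂ : S} (hz : z₁ < z₂)
    (h1 : lo ≤ z₁) (h2 : z₂ ≤ hi) (hf1 : f.1.eval z₁ = 0) (hf2 : f.1.eval z₂ = 0) :
    ∃ d ∈ D, z₁ ≤ d.1 ∧ d.1 ≤ z₂ := by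
  by_contra hcon
  push Not at hcon
  obtain ⟨d, hd, e, he, h3, h4, hadj⟩ := G.neighbors h1 (hz.le.trans h2)
    (fun d hd h => absurd (hcon d hd h.le) (not_lt.mpr (h ▸ hz.le)))
  have h5 := hcon e he h4.le
  obtain ⟨c, hc1, hc2, hc3⟩ := rolle hS f.1 z₁ z₂ hz hf1 hf2
  exact G.gap_ne hd he hadj (h3.trans hc1) (hc2.trans h5) hq hq0 (hqf ▸ hc3)

theorem mul_neg_of_sign {R R' : Type*} [Field R] [LinearOrder R] [IsStrictOrderedRing R]
    [Field R'] [LinearOrder R'] [IsStrictOrderedRing R'] {a b : R} {a' b' : R'}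
    (ha : SignType.sign a = SignType.sign a') (hb : SignType.sign b = SignType.sign b')
    (h : a * b < 0) : a' * b' < 0 := by
  rw [← sign_eq_neg_one_iff] at *
  rw [sign_mul] at *
  rw [← ha, ← hb, h]

theorem Good.partner (hS : PolyIVT S) (hS' : PolyIVT S') (G : Good lo hi lo' hi' T s D)
    {f q : S[X] × S'[X]} (hf : f ∈ T)
    (hq : q ∈ s) (hqf : q.1 = derivative f.1) (hq0 : q.1 ≠ 0) {z : S}
    (h1 : lo ≤ z) (h2 : z ≤ hi) (hz : f.1.eval z = 0) :
    ∃ z', f.2.eval z' = 0 ∧ Rel D z z' := by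
  by_cases h : ∃ d ∈ D, z = d.1
  · obtain ⟨d, hd, rfl⟩ := h
    refine ⟨d.2, ?_, G.mono d hd⟩
    have := G.signT d hd f hf
    rw [hz, sign_zero] at this
    exact sign_eq_zero_iff.mp this.symm
  · push Not at h
    obtain ⟨d, hd, e, he, h3, h4, hadj⟩ := G.neighbors h1 h2 h
    obtain ⟨u, hu1, hu2, hu3⟩ := mvt hS f.1 d.1 z h3
    obtain ⟨v, hv1, hv2, hv3⟩ := mvt hS f.1 z e.1 h4
    rw [← hqf, hz] at hu3 hv3
    have hs := G.gap_const hd he hadj hu1 (hu2.trans h4) (h3.trans hv1) hv2 hq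
    have hun := G.gap_ne hd he hadj hu1 (hu2.trans h4) hq hq0
    have hvu : 0 < q.1.eval u * q.1.eval v := by
      rw [← sign_eq_one_iff, sign_mul, ← hs, ← sign_mul, sign_eq_one_iff]
      exact mul_self_pos.mpr hun
    have hneg : f.1.eval d.1 * f.1.eval e.1 < 0 := by
      have e1 : f.1.eval d.1 = -(q.1.eval u * (z - d.1)) := by linarith
      have e2 : f.1.eval e.1 = q.1.eval v * (e.1 - z) := by linarith
      rw [e1, e2]
      have := mul_pos hvu (mul_pos (sub_pos.mpr h3) (sub_pos.mpr h4))
      nlinarith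
    have hneg' := mul_neg_of_sign (G.signT d hd f hf) (G.signT e he f hf) hneg
    have hlt : d.2 < e.2 := ((G.mono d hd e he).1).mp (h3.trans h4)
    obtain ⟨z', hz1, hz2, hz3⟩ := hS'.mul_neg f.2 d.2 e.2 hlt.le hneg'
    exact ⟨z', hz3, G.gap_rel hd he hadj h3 h4 hz1 hz2⟩

/-- two new pairs are ordered compatibly -/
theorem Good.pair_lt (hS : PolyIVT S) (G : Good lo hi lo' hi' T s D)
    {f q : S[X] × S'[X]} (hq : q ∈ s) (hqf : q.1 = derivative f.1) (hq0 : q.1 ≠ 0)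
    {z w : S} {z' w' : S'} (h1 : lo ≤ z) (h2 : w ≤ hi)
    (hz : f.1.eval z = 0) (hw : f.1.eval w = 0) (hrz : Rel D z z') (hrw : Rel D w w')
    (hlt : z < w) : z' < w' := by
  obtain ⟨d, hd, h3, h4⟩ := G.unique hS hq hqf hq0 hlt h1 h2 hz hw
  have h5 : z' ≤ d.2 := by rw [← not_lt, ← (hrz d hd).2, not_lt]; exact h3
  have h6 : d.2 ≤ w' := by rw [← not_lt, ← (hrw d hd).1, not_lt]; exact h4
  rcases h3.lt_or_eq with h | h
  · exact ((hrz d hd).1.mp h).trans_le h6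
  · exact h5.trans_lt ((hrw d hd).2.mp (h ▸ hlt))

/-- sign constancy: no root between -/
theorem sign_eq_of_no_root (hS : PolyIVT S) (p : S[X]) {a b : S} (hab : a ≤ b)
    (hno : ∀ c, a ≤ c → c ≤ b → p.eval c ≠ 0) :
    SignType.sign (p.eval a) = SignType.sign (p.eval b) := by
  have ha := hno a le_rfl hab
  have hb := hno b hab le_rfl
  rcases lt_or_gt_of_ne (mul_ne_zero ha hb) with h | h
  · obtain ⟨c, h1, h2, h3⟩ := hS.mul_neg p a b hab h
    exact absurd h3 (hno c h1.le h2.le)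
  · rcases mul_pos_iff.mp h with ⟨h1, h2⟩ | ⟨h1, h2⟩
    · rw [sign_pos h1, sign_pos h2]
    · rw [sign_neg h1, sign_neg h2]

theorem Good.step (hS : PolyIVT S) (hS' : PolyIVT S') (G : Good lo hi lo' hi' T s D)
    {f q : S[X] × S'[X]} (hf : f ∈ T)
    (hq : q ∈ s) (hqf : q.1 = derivative f.1) (hq0 : q.1 ≠ 0)
    (hqf' : q.2 = derivative f.2) (hq0' : q.2 ≠ 0)
    (hrem : ∀ F ∈ T, ∃ r ∈ s,
      (∀ z, f.1.eval z = 0 → SignType.sign (F.1.eval z) = SignType.sign (r.1.eval z)) ∧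
      (∀ z, f.2.eval z = 0 → SignType.sign (F.2.eval z) = SignType.sign (r.2.eval z))) :
    ∃ D', Good lo hi lo' hi' T (insert f s) D' := by
  classical
  have hf0 : f.1 ≠ 0 := by intro h; rw [h] at hqf; simp at hqf; exact hq0 hqf
  have hf0' : f.2 ≠ 0 := by intro h; rw [h] at hqf'; simp at hqf'; exact hq0' hqf'
  let N : Finset (S × S') := (f.1.roots.toFinset ×ˢ f.2.roots.toFinset).filter
    (fun c => lo ≤ c.1 ∧ c.1 ≤ hi ∧ Rel D c.1 c.2)
  have hN : ∀ c : S × S', c ∈ N ↔ (f.1.eval c.1 = 0 ∧ f.2.eval c.2 = 0) ∧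
      lo ≤ c.1 ∧ c.1 ≤ hi ∧ Rel D c.1 c.2 := by
    intro c; simp [N, hf0, hf0']
  have hrelD : ∀ {y y'}, Rel (D ∪ N) y y' → Rel D y y' := fun h d hd =>
    h d (Finset.mem_union_left _ hd)
  have hmono : ∀ e ∈ D ∪ N, Rel (D ∪ N) e.1 e.2 := by
    intro e he c hc
    rcases Finset.mem_union.mp he with he | he <;> rcases Finset.mem_union.mp hc with hc | hc
    · exact G.mono e he c hc
    · have := ((hN c).mp hc).2.2.2 e he
      exact ⟨this.2, this.1⟩
    · exact ((hN e).mp he).2.2.2 c hc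
    · obtain ⟨⟨e1, e2⟩, e3, e4, e5⟩ := (hN e).mp he
      obtain ⟨⟨c1, c2⟩, c3, c4, c5⟩ := (hN c).mp hc
      have re := G.range_of_rel e5
      have rc := G.range_of_rel c5
      have hqs : q.swap ∈ Prod.swap '' s := ⟨q, hq, rfl⟩
      exact ⟨⟨fun h => G.pair_lt hS hq hqf hq0 e3 c4 e1 c1 e5 c5 h,
          fun h => G.swap.pair_lt (f := f.swap) hS' hqs hqf' hq0' (re.1.mp e3) (rc.2.mp c4)
            e2 c2 e5.swap c5.swap h⟩,
        ⟨fun h => G.pair_lt hS hq hqf hq0 c3 e4 c1 e1 c5 e5 h,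
          fun h => G.swap.pair_lt (f := f.swap) hS' hqs hqf' hq0' (rc.1.mp c3) (re.2.mp e4)
            c2 e2 c5.swap e5.swap h⟩⟩
  have hsignT : ∀ d ∈ D ∪ N, ∀ F ∈ T,
      SignType.sign (F.1.eval d.1) = SignType.sign (F.2.eval d.2) := by
    intro d hd F hF
    rcases Finset.mem_union.mp hd with hd | hd
    · exact G.signT d hd F hF
    · obtain ⟨⟨e1, e2⟩, e3, e4, e5⟩ := (hN d).mp hd
      obtain ⟨r, hr, hr1, hr2⟩ := hrem F hF
      rw [hr1 _ e1, hr2 _ e2]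
      exact G.signs _ _ e3 e4 e5 r hr
  have hroot : ∀ z, lo ≤ z → z ≤ hi → f.1.eval z = 0 → ∃ c ∈ D ∪ N, c.1 = z := by
    intro z h1 h2 hz
    obtain ⟨z', h3, h4⟩ := G.partner hS hS' hf hq hqf hq0 h1 h2 hz
    exact ⟨(z, z'), Finset.mem_union_right _ ((hN _).mpr ⟨⟨hz, h3⟩, h1, h2, h4⟩), rfl⟩
  have hroot' : ∀ z, lo' ≤ z → z ≤ hi' → f.2.eval z = 0 → ∃ c ∈ D ∪ N, c.2 = z := by
    intro z h1 h2 hz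
    obtain ⟨z', h3, h4⟩ := G.swap.partner (f := f.swap) hS' hS ⟨f, hf, rfl⟩ ⟨q, hq, rfl⟩
      hqf' hq0' h1 h2 hz
    have h5 := h4.of_swap
    have rg := G.range_of_rel h5
    exact ⟨(z', z), Finset.mem_union_right _ ((hN _).mpr ⟨⟨h3, hz⟩, rg.1.mpr h1, rg.2.mpr h2,
      h5⟩), rfl⟩
  have hrange : ∀ d ∈ D ∪ N, lo ≤ d.1 ∧ d.1 ≤ hi := by
    intro d hd
    rcases Finset.mem_union.mp hd with hd | hd
    · exact G.range d hd
    · exact ⟨((hN d).mp hd).2.1, ((hN d).mp hd).2.2.1⟩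
  have G1 : Good lo hi lo' hi' T s (D ∪ N) :=
    ⟨Finset.mem_union_left _ G.mlo, Finset.mem_union_left _ G.mhi, hrange, hmono, hsignT,
      fun y y' h1 h2 h => G.signs y y' h1 h2 (hrelD h)⟩
  refine ⟨D ∪ N, G1.mlo, G1.mhi, hrange, hmono, hsignT, ?_⟩
  intro y y' h1 h2 h F hF
  rcases hF with rfl | hF
  swap
  · exact G1.signs y y' h1 h2 h F hF
  by_cases hy : ∃ d ∈ D ∪ N, y = d.1
  · obtain ⟨d, hd, rfl⟩ := hy
    rw [(h.eq_iff hd).mp rfl]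
    exact hsignT d hd F hf
  push Not at hy
  obtain ⟨d, hd, e, he, h3, h4, hadj⟩ := G1.neighbors h1 h2 hy
  have h3' := (h d hd).2.mp h3
  have h4' := (h e he).1.mp h4
  have rd := hrange d hd
  have re := hrange e he
  have rd' := G1.range_of_rel (hmono d hd)
  have re' := G1.range_of_rel (hmono e he)
  have no1 : ∀ c, d.1 < c → c < e.1 → F.1.eval c ≠ 0 := by
    intro c hc1 hc2 hc0
    obtain ⟨x, hx, rfl⟩ := hroot c (rd.1.trans hc1.le) (hc2.le.trans re.2) hc0
    rcases hadj x hx with hh | hh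
    · exact absurd hc1 (not_lt.mpr hh)
    · exact absurd hc2 (not_lt.mpr hh)
  have no2 : ∀ c, d.2 < c → c < e.2 → F.2.eval c ≠ 0 := by
    intro c hc1 hc2 hc0
    obtain ⟨x, hx, rfl⟩ := hroot' c ((rd'.1.mp rd.1).trans hc1.le) (hc2.le.trans (re'.2.mp re.2)) hc0
    rcases hadj x hx with hh | hh
    · exact absurd ((hmono d hd x hx).1.mpr hc1) (not_lt.mpr hh)
    · exact absurd ((hmono e he x hx).2.mpr hc2) (not_lt.mpr hh)
  by_cases hd0 : F.1.eval d.1 = 0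
  · have he0 : F.1.eval e.1 ≠ 0 := by
      intro he0
      obtain ⟨c, hc1, hc2, hc3⟩ := rolle hS F.1 d.1 e.1 (h3.trans h4) hd0 he0
      exact G1.gap_ne hd he hadj hc1 hc2 hq hq0 (hqf ▸ hc3)
    have he0' : F.2.eval e.2 ≠ 0 := by
      rw [← sign_ne_zero, ← hsignT e he F hf, sign_ne_zero]; exact he0
    rw [sign_eq_of_no_root hS F.1 h4.le, sign_eq_of_no_root hS' F.2 h4'.le]
    · exact hsignT e he F hf
    · intro c hc1 hc2
      rcases hc2.lt_or_eq with hc2 | rfl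
      · exact no2 c (h3'.trans_le hc1) hc2
      · exact he0'
    · intro c hc1 hc2
      rcases hc2.lt_or_eq with hc2 | rfl
      · exact no1 c (h3.trans_le hc1) hc2
      · exact he0
  · have hd0' : F.2.eval d.2 ≠ 0 := by
      rw [← sign_ne_zero, ← hsignT d hd F hf, sign_ne_zero]; exact hd0
    rw [← sign_eq_of_no_root hS F.1 h3.le, ← sign_eq_of_no_root hS' F.2 h3'.le]
    · exact hsignT d hd F hf
    · intro c hc1 hc2
      rcases hc1.lt_or_eq with hc1 | rfl
      · exact no2 c hc1 (hc2.trans_lt h4')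
      · exact hd0'
    · intro c hc1 hc2
      rcases hc1.lt_or_eq with hc1 | rfl
      · exact no1 c hc1 (hc2.trans_lt h4)
      · exact hd0

end Table
end Polynomial.CP
end

section
open MvPolynomial
namespace Polynomial.CP
open scoped Polynomial
set_option linter.unusedSectionVars false

section Closure
variable {A : Type*} [CommRing A]

theorem exists_prem (g : A[X]) (hg : 1 ≤ g.natDegree) (F : A[X]) :
    ∃ (r : A[X]) (k : ℕ) (q : A[X]), C (g.leadingCoeff ^ (2 * k)) * F = q * g + r ∧
      r.natDegree < g.natDegree ∧ (F.natDegree < g.natDegree → r = F) := by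
  induction hd : F.natDegree using Nat.strong_induction_on generalizing F with
  | _ d ih =>
  by_cases h : F.natDegree < g.natDegree
  · exact ⟨F, 0, 0, by simp, h, fun _ => rfl⟩
  · have h' := not_lt.mp h
    have hlt := natDegree_cancelLeads_lt_of_natDegree_le_natDegree h' (by lia)
    have hlt2 : (C g.leadingCoeff * g.cancelLeads F).natDegree < d :=
      (natDegree_C_mul_le _ _).trans_lt (hd ▸ hlt)
    obtain ⟨r, k, q, h1, h2, h3⟩ := ih _ hlt2 _ rfl
    refine ⟨r, k + 1, q + C (g.leadingCoeff ^ (2 * k + 1)) * (C F.leadingCoeff *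
      X ^ (F.natDegree - g.natDegree)), ?_, h2, fun h4 => absurd h4 (hd ▸ h)⟩
    rw [cancelLeads, Nat.sub_eq_zero_of_le h'] at h1
    simp only [map_pow] at h1 ⊢
    linear_combination h1

/-- pseudo-remainder -/
noncomputable def prem (F g : A[X]) : A[X] :=
  open Classical in
  if hg : 1 ≤ g.natDegree then (exists_prem g hg F).choose else 0

theorem prem_spec (F g : A[X]) (hg : 1 ≤ g.natDegree) :
    ∃ (k : ℕ) (q : A[X]), C (g.leadingCoeff ^ (2 * k)) * F = q * g + prem F g ∧
      (prem F g).natDegree < g.natDegree ∧ (F.natDegree < g.natDegree → prem F g = F) := by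
  rw [prem, dif_pos hg]
  exact (exists_prem g hg F).choose_spec

/-- closure condition -/
def ClosedAt (T s : Finset A[X]) (k : ℕ) : Prop :=
  ∀ g ∈ s, k ≤ g.natDegree → derivative g ∈ s ∧ eraseLead g ∈ s ∧ ∀ F ∈ T, prem F g ∈ s

theorem closed_step (T : Finset A[X]) (k : ℕ) (hk : 1 ≤ k) (h : ClosedAt T T (k + 1)) :
    ∃ T', T ⊆ T' ∧ ClosedAt T' T' k := by
  classical
  let G := T.filter (fun g => g.natDegree = k)
  let N := G.image (fun g => derivative g) ∪ G.image eraseLead ∪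
    (T ×ˢ G).image (fun c => prem c.1 c.2)
  have hNd : ∀ g ∈ N, g.natDegree < k := by
    intro g hg
    simp only [N, Finset.mem_union, Finset.mem_image, Finset.mem_product] at hg
    rcases hg with (⟨u, hu, rfl⟩ | ⟨u, hu, rfl⟩) | ⟨⟨u, v⟩, ⟨-, hv⟩, rfl⟩
    · have := (Finset.mem_filter.mp hu).2
      rw [← this]
      exact natDegree_derivative_lt (by lia)
    · have := (Finset.mem_filter.mp hu).2
      have := eraseLead_natDegree_le u
      lia
    · have := (Finset.mem_filter.mp hv).2
      obtain ⟨_, _, _, h2, _⟩ := prem_spec u v (by lia)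
      exact this ▸ h2
  refine ⟨T ∪ N, Finset.subset_union_left, ?_⟩
  intro g hg hgk
  have hgT : g ∈ T := by
    rcases Finset.mem_union.mp hg with h1 | h1
    · exact h1
    · exact absurd (hNd g h1) (by lia)
  have hnew : ∀ F ∈ N, prem F g ∈ T ∪ N := by
    intro F hF
    obtain ⟨_, _, _, _, h3⟩ := prem_spec F g (by lia)
    rw [h3 ((hNd F hF).trans_le hgk)]
    exact Finset.mem_union_right _ hF
  rcases hgk.lt_or_eq with h1 | h1
  · obtain ⟨a1, a2, a3⟩ := h g hgT h1
    refine ⟨Finset.mem_union_left _ a1, Finset.mem_union_left _ a2, fun F hF => ?_⟩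
    rcases Finset.mem_union.mp hF with h2 | h2
    · exact Finset.mem_union_left _ (a3 F h2)
    · exact hnew F h2
  · have hgG : g ∈ G := Finset.mem_filter.mpr ⟨hgT, h1.symm⟩
    refine ⟨Finset.mem_union_right _ ?_, Finset.mem_union_right _ ?_, fun F hF => ?_⟩
    · simp only [N, Finset.mem_union, Finset.mem_image]
      exact .inl (.inl ⟨g, hgG, rfl⟩)
    · simp only [N, Finset.mem_union, Finset.mem_image]
      exact .inl (.inr ⟨g, hgG, rfl⟩)
    · rcases Finset.mem_union.mp hF with h2 | h2
      · apply Finset.mem_union_right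
        simp only [N, Finset.mem_union, Finset.mem_image]
        exact .inr ⟨(F, g), Finset.mem_product.mpr ⟨h2, hgG⟩, rfl⟩
      · exact hnew F h2

theorem exists_closed (T₀ : Finset A[X]) : ∃ T, T₀ ⊆ T ∧ ClosedAt T T 1 := by
  obtain ⟨d, hd⟩ : ∃ d, ∀ g ∈ T₀, g.natDegree ≤ d :=
    ⟨T₀.sup natDegree, fun g hg => Finset.le_sup (f := natDegree) hg⟩
  have : ∀ j ≤ d, ∃ T, T₀ ⊆ T ∧ ClosedAt T T (d + 1 - j) := by
    intro j
    induction j with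
    | zero => exact fun _ => ⟨T₀, le_rfl, fun g hg h => absurd (hd g hg) (by lia)⟩
    | succ j ih =>
      intro hj
      obtain ⟨T, h1, h2⟩ := ih (by lia)
      have e : d + 1 - j = (d + 1 - (j + 1)) + 1 := by lia
      rw [e] at h2
      obtain ⟨T', h3, h4⟩ := closed_step T _ (by lia) h2
      exact ⟨T', h1.trans h3, h4⟩
  simpa using this d le_rfl

variable {S S' : Type*} [Field S] [LinearOrder S] [IsStrictOrderedRing S]
  [Field S'] [LinearOrder S'] [IsStrictOrderedRing S']

theorem map_eraseLead_of {R : Type*} [CommRing R] (φ : A →+* R) (f : A[X])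
    (h : φ f.leadingCoeff = 0) : f.map φ = f.eraseLead.map φ := by
  have h1 := congrArg (fun p => p.map φ) (eraseLead_add_C_mul_X_pow f)
  simp only [Polynomial.map_add, Polynomial.map_mul, map_C, h, map_zero, zero_mul, add_zero] at h1
  exact h1.symm

theorem sentinel (φ : A →+* S) (ψ : A →+* S') (T : Finset A[X]) (hT : ClosedAt T T 1)
    (hlc : ∀ f ∈ T, SignType.sign (φ f.leadingCoeff) = SignType.sign (ψ f.leadingCoeff))
    (f : A[X]) (hf : f ∈ T) :
    ∃ (B : S) (B' : S'), ∀ y y', B ≤ y → B' ≤ y' →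
      SignType.sign ((f.map φ).eval y) = SignType.sign ((f.map ψ).eval y') ∧
      SignType.sign ((f.map φ).eval (-y)) = SignType.sign ((f.map ψ).eval (-y')) := by
  induction hd : f.natDegree using Nat.strong_induction_on generalizing f with
  | _ d ih =>
  have hs := hlc f hf
  by_cases h0 : φ f.leadingCoeff = 0
  · have h0' : ψ f.leadingCoeff = 0 := by
      rw [h0, sign_zero] at hs; exact sign_eq_zero_iff.mp hs.symm
    rw [map_eraseLead_of φ f h0, map_eraseLead_of ψ f h0']
    by_cases hd1 : 1 ≤ f.natDegree
    · have := eraseLead_natDegree_le f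
      exact ih _ (by lia) _ (hT f hf hd1).2.1 rfl
    · have : f.eraseLead = 0 := by
        rw [eq_C_of_natDegree_eq_zero (p := f) (by lia)]; simp
      rw [this]; exact ⟨0, 0, by simp⟩
  · have h0' : ψ f.leadingCoeff ≠ 0 := by
      rw [← sign_ne_zero, ← hs, sign_ne_zero]; exact h0
    have e1 := natDegree_map_of_leadingCoeff_ne_zero φ h0
    have e1' := natDegree_map_of_leadingCoeff_ne_zero ψ h0'
    have e2 := leadingCoeff_map_of_leadingCoeff_ne_zero φ h0
    have e2' := leadingCoeff_map_of_leadingCoeff_ne_zero ψ h0'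
    have n1 : f.map φ ≠ 0 := by rw [← leadingCoeff_ne_zero, e2]; exact h0
    have n1' : f.map ψ ≠ 0 := by rw [← leadingCoeff_ne_zero, e2']; exact h0'
    obtain ⟨B1, H1⟩ := sign_at_top' _ n1
    obtain ⟨B2, H2⟩ := sign_at_bot' _ n1
    obtain ⟨B1', H1'⟩ := sign_at_top' _ n1'
    obtain ⟨B2', H2'⟩ := sign_at_bot' _ n1'
    refine ⟨max B1 B2, max B1' B2', fun y y' hy hy' => ?_⟩
    rw [H1 y ((le_max_left _ _).trans hy), H2 y ((le_max_right _ _).trans hy),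
      H1' y' ((le_max_left _ _).trans hy'), H2' y' ((le_max_right _ _).trans hy'),
      e1, e1', e2, e2']
    refine ⟨hs, ?_⟩
    rw [sign_mul, sign_mul, hs]
    congr 1
    rcases neg_one_pow_eq_or S f.natDegree with h | h <;>
    rcases neg_one_pow_eq_or S' f.natDegree with h' | h' <;>
    rcases Nat.even_or_odd f.natDegree with h3 | h3 <;> simp [h3.neg_one_pow]

theorem sign_rem {R : Type*} [Field R] [LinearOrder R] [IsStrictOrderedRing R] (φ : A →+* R)
    (F g : A[X]) (hg : 1 ≤ g.natDegree) (h0 : φ g.leadingCoeff ≠ 0) (z : R)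
    (hz : (g.map φ).eval z = 0) :
    SignType.sign ((F.map φ).eval z) = SignType.sign (((prem F g).map φ).eval z) := by
  obtain ⟨k, q, h1, -, -⟩ := prem_spec F g hg
  have h2 := congrArg (fun p => (p.map φ).eval z) h1
  simp only [Polynomial.map_mul, Polynomial.map_add, map_C, eval_mul, eval_add, eval_C, hz,
    mul_zero, zero_add] at h2
  have h3 : 0 < φ (g.leadingCoeff ^ (2 * k)) := by
    rw [map_pow, pow_mul]; positivity
  rw [← h2, sign_mul, sign_pos h3, one_mul]

theorem map_derivative_ne {R : Type*} [Field R] [LinearOrder R] [IsStrictOrderedRing R]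
    (a : A[X]) (hd1 : 1 ≤ a.natDegree) (χ : A →+* R)
    (h0 : χ a.leadingCoeff ≠ 0) : (derivative a).map χ ≠ 0 := by
  intro h
  have := congrArg (fun p => p.coeff (a.natDegree - 1)) h
  simp only [coeff_map, coeff_derivative, coeff_zero, map_mul] at this
  rw [Nat.sub_add_cancel hd1, coeff_natDegree] at this
  rcases mul_eq_zero.mp this with h | h
  · exact h0 h
  · simp only [map_add, map_natCast, map_one] at h
    have : (0 : R) < ((a.natDegree - 1 : ℕ) : R) + 1 := by positivity
    exact this.ne' h

theorem table (hS : PolyIVT S) (hS' : PolyIVT S') (φ : A →+* S) (ψ : A →+* S')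
    (T : Finset A[X]) (hT : ClosedAt T T 1)
    (hlc : ∀ f ∈ T, SignType.sign (φ f.leadingCoeff) = SignType.sign (ψ f.leadingCoeff))
    (y : S) : ∃ y' : S', ∀ f ∈ T,
      SignType.sign ((f.map φ).eval y) = SignType.sign ((f.map ψ).eval y') := by
  classical
  choose! B B' hB using sentinel φ ψ T hT hlc
  obtain ⟨M, hM⟩ := (T.image B).exists_le
  obtain ⟨M', hM'⟩ := (T.image B').exists_le
  obtain ⟨b, hb1, hb2, hb3⟩ : ∃ b : S, M ≤ b ∧ |y| ≤ b ∧ 0 < b :=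
    ⟨max (max M |y|) 1, by simp, by simp, by simp⟩
  obtain ⟨b', hb1', hb3'⟩ : ∃ b : S', M' ≤ b ∧ 0 < b :=
    ⟨max M' 1, by simp, by simp⟩
  let pr : A[X] → S[X] × S'[X] := fun f => (f.map φ, f.map ψ)
  have key : ∀ s : Finset A[X], s ⊆ T → ClosedAt T s 1 →
      ∃ D, Good (-b) b (-b') b' (pr '' (T : Set A[X])) (pr '' (s : Set A[X])) D := by
    intro s
    refine Finset.induction_on_max_value natDegree s ?_ ?_
    · intro _ _
      refine ⟨{(-b, -b'), (b, b')}, ⟨by simp, by simp, ?_, ?_, ?_, by simp⟩⟩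
      · intro d hd
        rw [Finset.mem_insert, Finset.mem_singleton] at hd
        rcases hd with rfl | rfl <;> constructor <;> simp <;> linarith
      · intro d hd c hc
        rw [Finset.mem_insert, Finset.mem_singleton] at hd hc
        have a1 : -b < b := by linarith
        have a2 : -b' < b' := by linarith
        rcases hd with rfl | rfl <;> rcases hc with rfl | rfl <;>
          simp [a1, a2, -neg_lt_self_iff, -lt_neg_self_iff,
            a1.not_gt, a2.not_gt]
      · rintro d hd _ ⟨F, hF, rfl⟩
        have := hB F hF b b' ((hM _ (Finset.mem_image_of_mem _ hF)).trans hb1)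
          ((hM' _ (Finset.mem_image_of_mem _ hF)).trans hb1')
        rw [Finset.mem_insert, Finset.mem_singleton] at hd
        rcases hd with rfl | rfl
        · exact this.2
        · exact this.1
    · intro a s has hmax ih
      intro hsub hcl
      have haT : a ∈ T := hsub (Finset.mem_insert_self _ _)
      -- lower-degree outputs stay in `s`
      have hlow : ∀ u ∈ insert a s, u.natDegree < a.natDegree → u ∈ s := by
        intro u hu hlt
        rcases Finset.mem_insert.mp hu with rfl | h
        · exact absurd hlt (lt_irrefl _)
        · exact h
      have hcl' : ∀ g ∈ insert a s, 1 ≤ g.natDegree →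
          derivative g ∈ s ∧ eraseLead g ∈ s ∧ ∀ F ∈ T, prem F g ∈ s := by
        intro g hg h1
        have hga : g.natDegree ≤ a.natDegree := by
          rcases Finset.mem_insert.mp hg with rfl | h
          · exact le_rfl
          · exact hmax g h
        obtain ⟨c1, c2, c3⟩ := hcl g hg h1
        refine ⟨hlow _ c1 ((natDegree_derivative_lt (by lia)).trans_le hga), hlow _ c2 ?_,
          fun F hF => hlow _ (c3 F hF) ?_⟩
        · have := eraseLead_natDegree_le g; lia
        · obtain ⟨_, _, _, h2, _⟩ := prem_spec F g h1
          exact h2.trans_le hga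
      obtain ⟨D, G⟩ := ih ((Finset.subset_insert _ _).trans hsub)
        (fun g hg => hcl' g (Finset.mem_insert_of_mem hg))
      have ext : (∀ y y', -b ≤ y → y ≤ b → Rel D y y' →
          SignType.sign ((a.map φ).eval y) = SignType.sign ((a.map ψ).eval y')) →
          ∃ D, Good (-b) b (-b') b' (pr '' (T : Set A[X]))
            (pr '' ((insert a s : Finset A[X]) : Set A[X])) D := by
        intro H
        refine ⟨D, G.mlo, G.mhi, G.range, G.mono, G.signT, ?_⟩
        rintro y y' h1 h2 h _ ⟨F, hF, rfl⟩
        rcases Finset.mem_insert.mp (Finset.mem_coe.mp hF) with rfl | hF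
        · exact H y y' h1 h2 h
        · exact G.signs y y' h1 h2 h _ ⟨F, hF, rfl⟩
      have hs := hlc a haT
      by_cases hd1 : 1 ≤ a.natDegree
      · obtain ⟨c1, c2, c3⟩ := hcl' a (Finset.mem_insert_self _ _) hd1
        by_cases h0 : φ a.leadingCoeff = 0
        · have h0' : ψ a.leadingCoeff = 0 := by
            rw [h0, sign_zero] at hs; exact sign_eq_zero_iff.mp hs.symm
          apply ext
          intro y y' h1 h2 h
          rw [map_eraseLead_of φ a h0, map_eraseLead_of ψ a h0']
          exact G.signs y y' h1 h2 h _ ⟨_, c2, rfl⟩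
        · have h0' : ψ a.leadingCoeff ≠ 0 := by
            rw [← sign_ne_zero, ← hs, sign_ne_zero]; exact h0
          obtain ⟨D', G'⟩ := G.step hS hS' (f := pr a) (q := pr (derivative a))
            ⟨a, haT, rfl⟩ ⟨_, c1, rfl⟩ (derivative_map a φ).symm (map_derivative_ne a hd1 φ h0)
            (derivative_map a ψ).symm (map_derivative_ne a hd1 ψ h0') (by
              rintro _ ⟨F, hF, rfl⟩
              exact ⟨_, ⟨_, c3 F hF, rfl⟩, fun z hz => sign_rem φ F a hd1 h0 z hz,
                fun z hz => sign_rem ψ F a hd1 h0' z hz⟩)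
          refine ⟨D', ?_⟩
          rw [Finset.coe_insert, Set.image_insert_eq]
          exact G'
      · apply ext
        intro y y' _ _ _
        have e := eq_C_of_natDegree_eq_zero (p := a) (by lia)
        have hlc0 : a.leadingCoeff = a.coeff 0 := by rw [leadingCoeff]; congr 1; lia
        rw [e]
        simp only [map_C, eval_C]
        rw [← hlc0]; exact hs
  obtain ⟨D, G⟩ := key T le_rfl hT
  have := abs_le.mp hb2
  obtain ⟨y', hy'⟩ := G.lift this.1 this.2
  exact ⟨y', fun f hf => G.signs y y' this.1 this.2 hy' _ ⟨f, hf, rfl⟩⟩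

end Closure

section Transfer
variable {S S' : Type*} [Field S] [LinearOrder S] [IsStrictOrderedRing S]
  [Field S'] [LinearOrder S'] [IsStrictOrderedRing S']

theorem eval₂_cons {k : Type*} [CommRing k] (ι : k →+* S) (n : ℕ) (y : S) (x : Fin n → S)
    (f : MvPolynomial (Fin (n + 1)) k) :
    MvPolynomial.eval₂Hom ι (Fin.cons y x : Fin (n + 1) → S) f =
      ((MvPolynomial.finSuccEquiv k n f).map (MvPolynomial.eval₂Hom ι x)).eval y := by
  have : MvPolynomial.eval₂Hom ι (Fin.cons y x : Fin (n + 1) → S) =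
      ((evalRingHom y).comp (mapRingHom (MvPolynomial.eval₂Hom ι x))).comp
        (MvPolynomial.finSuccEquiv k n : MvPolynomial (Fin (n + 1)) k →+* _) := by
    apply MvPolynomial.ringHom_ext
    · intro r; simp [MvPolynomial.finSuccEquiv_apply]
    · intro i
      refine Fin.cases ?_ (fun j => ?_) i <;> simp [MvPolynomial.finSuccEquiv_X_zero, MvPolynomial.finSuccEquiv_X_succ]
  exact congrArg (fun h => h f) this

theorem transfer_step {A : Type*} [CommRing A] (hS : PolyIVT S) (hS' : PolyIVT S') (φ : A →+* S)
    (Q : (A →+* S') → Prop)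
    (ih : ∀ G : Finset A, ∃ ψ, Q ψ ∧ ∀ c ∈ G, SignType.sign (φ c) = SignType.sign (ψ c))
    (T₀ : Finset A[X]) (y : S) : ∃ ψ, Q ψ ∧ ∃ y' : S', ∀ f ∈ T₀,
      SignType.sign ((f.map φ).eval y) = SignType.sign ((f.map ψ).eval y') := by
  classical
  obtain ⟨T, hT1, hT2⟩ := exists_closed T₀
  obtain ⟨ψ, hQ, hψ⟩ := ih (T.image (fun f => f.leadingCoeff))
  obtain ⟨y', hy'⟩ := table hS hS' φ ψ T hT2
      (fun f hf => hψ _ (Finset.mem_image_of_mem _ hf)) y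
  exact ⟨ψ, hQ, y', fun f hf => hy' f (hT1 hf)⟩

theorem transfer {k : Type*} [CommRing k] (hS : PolyIVT S) (hS' : PolyIVT S')
    (ι : k →+* S) (ι' : k →+* S')
    (hι : ∀ r, SignType.sign (ι r) = SignType.sign (ι' r)) (n : ℕ)
    (F : Finset (MvPolynomial (Fin n) k)) (x : Fin n → S) :
    ∃ x' : Fin n → S', ∀ f ∈ F, SignType.sign (MvPolynomial.eval₂Hom ι x f) =
      SignType.sign (MvPolynomial.eval₂Hom ι' x' f) := by
  classical
  induction n with
  | zero =>
    refine ⟨fun i => i.elim0, fun f _ => ?_⟩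
    rw [MvPolynomial.eq_C_of_isEmpty f]
    simpa using hι _
  | succ n ih =>
    obtain ⟨ψ, ⟨x', rfl⟩, y', hy'⟩ := transfer_step hS hS'
      (MvPolynomial.eval₂Hom ι (fun i => x i.succ))
      (fun ψ => ∃ x', ψ = MvPolynomial.eval₂Hom ι' x')
      (by
        intro G
        obtain ⟨x', hx'⟩ := ih G (fun i => x i.succ)
        exact ⟨_, ⟨x', rfl⟩, hx'⟩)
      (F.image (fun f => MvPolynomial.finSuccEquiv k n f)) (x 0)
    refine ⟨Fin.cons y' x', fun f hf => ?_⟩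
    have e : x = (Fin.cons (x 0) (fun i => x i.succ) : Fin (n + 1) → S) :=
      (Fin.cons_self_tail x).symm
    have h1 := hy' _ (Finset.mem_image_of_mem _ hf)
    rw [← eval₂_cons, ← eval₂_cons, ← e] at h1
    exact h1

end Transfer
end Polynomial.CP
end

section
open MvPolynomial
namespace Polynomial.CP
open scoped Polynomial
set_option linter.unusedSectionVars false

section Preord
variable {A : Type*} [CommRing A]

/-- `{p + q a}` for a subsemiring containing squares. -/
def adjoinElt (Q : Subsemiring A) (hsq : ∀ a, a * a ∈ Q) (a : A) : Subsemiring A where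
  carrier := {x | ∃ p ∈ Q, ∃ q ∈ Q, x = p + q * a}
  mul_mem' := by
    rintro x y ⟨p, hp, q, hq, rfl⟩ ⟨p', hp', q', hq', rfl⟩
    exact ⟨p * p' + q * q' * (a * a), Q.add_mem (Q.mul_mem hp hp') (Q.mul_mem (Q.mul_mem hq hq') (hsq a)),
      p * q' + q * p', Q.add_mem (Q.mul_mem hp hq') (Q.mul_mem hq hp'), by ring⟩
  one_mem' := ⟨1, Q.one_mem, 0, Q.zero_mem, by ring⟩
  add_mem' := by
    rintro x y ⟨p, hp, q, hq, rfl⟩ ⟨p', hp', q', hq', rfl⟩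
    exact ⟨p + p', Q.add_mem hp hp', q + q', Q.add_mem hq hq', by ring⟩
  zero_mem' := ⟨0, Q.zero_mem, 0, Q.zero_mem, by ring⟩

theorem exists_maxPre (P : Subsemiring A) (hsq : ∀ a, a * a ∈ P) (h1 : -1 ∉ P) :
    ∃ Q : Subsemiring A, P ≤ Q ∧ -1 ∉ Q ∧
      (∀ a, a ∉ Q → ∃ p ∈ Q, ∃ q ∈ Q, -1 = p + q * a) ∧ ∀ a, a ∈ Q ∨ -a ∈ Q := by
  obtain ⟨Q, hPQ, hQ⟩ := zorn_le_nonempty₀ {Q : Subsemiring A | P ≤ Q ∧ -1 ∉ Q} (by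
    intro c hc hch y hy
    refine ⟨sSup c, ⟨(hc hy).1.trans (le_sSup hy), ?_⟩, fun z hz => le_sSup hz⟩
    rw [Subsemiring.mem_sSup_of_directedOn ⟨y, hy⟩ hch.directedOn]
    rintro ⟨s, hs, h⟩
    exact (hc hs).2 h) P ⟨le_rfl, h1⟩
  have hsq' : ∀ a, a * a ∈ Q := fun a => hPQ (hsq a)
  have key : ∀ a, a ∉ Q → ∃ p ∈ Q, ∃ q ∈ Q, -1 = p + q * a := by
    intro a ha
    by_contra hcon
    have hle : Q ≤ adjoinElt Q hsq' a := fun x hx => ⟨x, hx, 0, Q.zero_mem, by ring⟩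
    have := hQ.2 (y := adjoinElt Q hsq' a) ⟨hPQ.trans hle, hcon⟩ hle
    exact ha (this ⟨0, Q.zero_mem, 1, Q.one_mem, by ring⟩)
  refine ⟨Q, hPQ, hQ.1.2, key, fun a => ?_⟩
  by_contra hcon
  push Not at hcon
  obtain ⟨p, hp, q, hq, e⟩ := key a hcon.1
  obtain ⟨p', hp', q', hq', e'⟩ := key _ hcon.2
  apply hQ.1.2
  have : (-1 : A) = q * q' * (a * a) + p + p' + p * p' := by
    linear_combination (1 + p') * e - q * a * e'
  rw [this]
  exact Q.add_mem (Q.add_mem (Q.add_mem (Q.mul_mem (Q.mul_mem hq hq') (hsq' a)) hp) hp')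
    (Q.mul_mem hp hp')

/-- Support of a maximal preordering. -/
def suppIdeal (Q : Subsemiring A) (htot : ∀ a, a ∈ Q ∨ -a ∈ Q) : Ideal A where
  carrier := {a | a ∈ Q ∧ -a ∈ Q}
  add_mem' := by
    rintro a b ⟨h1, h2⟩ ⟨h3, h4⟩
    exact ⟨Q.add_mem h1 h3, by rw [neg_add]; exact Q.add_mem h2 h4⟩
  zero_mem' := ⟨Q.zero_mem, by rw [neg_zero]; exact Q.zero_mem⟩
  smul_mem' := by
    rintro c a ⟨h1, h2⟩
    rcases htot c with h | h
    · exact ⟨Q.mul_mem h h1, by rw [smul_eq_mul, ← mul_neg]; exact Q.mul_mem h h2⟩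
    · refine ⟨?_, ?_⟩
      · have := Q.mul_mem h h2
        rwa [neg_mul_neg] at this
      · have := Q.mul_mem h h1
        rwa [neg_mul] at this

theorem suppIdeal_prime (Q : Subsemiring A) (htot : ∀ a, a ∈ Q ∨ -a ∈ Q) (h1 : -1 ∉ Q)
    (hmax : ∀ a, a ∉ Q → ∃ p ∈ Q, ∃ q ∈ Q, -1 = p + q * a) : (suppIdeal Q htot).IsPrime := by
  have key : ∀ a, a ∉ suppIdeal Q htot → ∃ p ∈ Q, ∃ q : A, 1 + p = q * a := by
    intro a ha
    by_cases h : a ∈ Q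
    · have h' : -a ∉ Q := fun h' => ha ⟨h, h'⟩
      obtain ⟨p, hp, q, hq, e⟩ := hmax _ h'
      exact ⟨p, hp, q, by linear_combination -e⟩
    · obtain ⟨p, hp, q, hq, e⟩ := hmax _ h
      exact ⟨p, hp, -q, by linear_combination -e⟩
  constructor
  · intro h
    exact h1 (((Ideal.eq_top_iff_one _).mp h).2)
  · intro a b hab
    by_contra hcon
    push Not at hcon
    obtain ⟨p, hp, q, e⟩ := key a hcon.1
    obtain ⟨p', hp', q', e'⟩ := key b hcon.2
    have h2 : q * q' * (a * b) ∈ suppIdeal Q htot := Ideal.mul_mem_left _ _ hab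
    apply h1
    have : (-1 : A) = p + p' + p * p' + -(q * q' * (a * b)) := by
      linear_combination (-1 - p') * e - q * a * e'
    rw [this]
    exact Q.add_mem (Q.add_mem (Q.add_mem hp hp') (Q.mul_mem hp hp')) h2.2

end Preord

/-- A proper preordering of a field extends to a field ordering. -/
theorem exists_order {S : Type*} [Field S] (P : Subsemiring S) (hsq : ∀ a, a * a ∈ P)
    (h1 : -1 ∉ P) : ∃ (_ : LinearOrder S), IsStrictOrderedRing S ∧ ∀ p ∈ P, 0 ≤ p := by
  classical
  obtain ⟨Q, hPQ, hQ1, -, htot⟩ := exists_maxPre P hsq h1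
  have hz : ∀ {a}, a ∈ Q → -a ∈ Q → a = 0 := by
    intro a ha hna
    by_contra h0
    apply hQ1
    have : (-1 : S) = (-a) * a * (a⁻¹ * a⁻¹) := by field_simp
    rw [this]
    exact Q.mul_mem (Q.mul_mem hna ha) (hPQ (hsq _))
  let R : RingCone S := { Q with eq_zero_of_mem_of_neg_mem' := fun {a} => hz }
  have : HasMemOrNegMem R := ⟨htot⟩
  let _ : LinearOrder S := LinearOrder.mkOfAddGroupCone R
  have : IsOrderedRing S := IsOrderedRing.mkOfCone R
  refine ⟨inferInstance, IsOrderedRing.toIsStrictOrderedRing S, fun p hp => ?_⟩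
  change p - 0 ∈ Q
  rw [sub_zero]; exact hPQ hp

section Claim
variable {S : Type*} [Field S] [LinearOrder S] [IsStrictOrderedRing S]

/-- Sums `∑ cᵢ sᵢ²` with `cᵢ ≥ 0`. -/
noncomputable def wsos (S : Type*) [Field S] [LinearOrder S] : AddSubmonoid S[X] :=
  AddSubmonoid.closure {u | ∃ (c : S) (s : S[X]), 0 ≤ c ∧ u = C c * s ^ 2}

theorem wsos_eval {u : S[X]} (hu : u ∈ wsos S) (a : S) : 0 ≤ u.eval a := by
  induction hu using AddSubmonoid.closure_induction with
  | mem x hx =>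
    obtain ⟨c, s, hc, rfl⟩ := hx
    rw [eval_mul, eval_C, eval_pow]; positivity
  | zero => simp
  | add x y _ _ hx hy => rw [eval_add]; positivity

theorem wsos_mod (f : S[X]) (hf : f.natDegree ≠ 0) {u : S[X]} (hu : u ∈ wsos S) :
    ∃ u' ∈ wsos S, f ∣ u - u' ∧ u'.natDegree ≤ 2 * (f.natDegree - 1) := by
  induction hu using AddSubmonoid.closure_induction with
  | mem x hx =>
    obtain ⟨c, s, hc, rfl⟩ := hx
    refine ⟨C c * (s % f) ^ 2, AddSubmonoid.subset_closure ⟨c, _, hc, rfl⟩, ?_, ?_⟩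
    · have : C c * s ^ 2 - C c * (s % f) ^ 2 = (s - s % f) * (C c * (s + s % f)) := by ring
      rw [this]
      exact Dvd.dvd.mul_right ⟨s / f, by linear_combination -EuclideanDomain.div_add_mod s f⟩ _
    · refine (natDegree_C_mul_le _ _).trans ((natDegree_pow_le).trans ?_)
      have := natDegree_mod_lt s hf
      exact Nat.mul_le_mul_left _ (by lia)
  | zero => exact ⟨0, zero_mem _, by simp, by simp⟩
  | add x y _ _ hx hy =>
    obtain ⟨x', h1, h2, h3⟩ := hx
    obtain ⟨y', h4, h5, h6⟩ := hy
    refine ⟨x' + y', add_mem h1 h4, ?_, (natDegree_add_le _ _).trans (max_le h3 h6)⟩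
    rw [add_sub_add_comm]
    exact dvd_add h2 h5

theorem exists_irr_factor (h : S[X]) (a b : S) (hh : h.eval a * h.eval b < 0) :
    ∃ h1, Irreducible h1 ∧ h1 ∣ h ∧ h1.eval a * h1.eval b < 0 := by
  induction h using WfDvdMonoid.induction_on_irreducible with
  | zero => simp at hh
  | unit u hu =>
    obtain ⟨r, -, rfl⟩ := Polynomial.isUnit_iff.mp hu
    rw [eval_C, eval_C] at hh
    exact absurd hh (not_lt.mpr (mul_self_nonneg r))
  | mul x i hx hi ih =>
    by_cases h1 : i.eval a * i.eval b < 0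
    · exact ⟨i, hi, dvd_mul_right _ _, h1⟩
    · have : x.eval a * x.eval b < 0 := by
        rw [eval_mul, eval_mul] at hh
        by_contra h2
        have := mul_nonneg (not_lt.mp h1) (not_lt.mp h2)
        nlinarith
      obtain ⟨h1, h2, h3, h4⟩ := ih this
      exact ⟨h1, h2, h3.mul_left _, h4⟩

theorem irr_claim (d : ℕ) : ∀ (f : S[X]), Irreducible f → f.natDegree = d → ∀ a b,
    f.eval a * f.eval b < 0 → ∀ u ∈ wsos S, ¬ f ∣ 1 + u := by
  induction d using Nat.strong_induction_on with
  | _ d ih =>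
  intro f hf hd a b hab u hu hdvd
  have hf0 : f.natDegree ≠ 0 := hf.natDegree_pos.ne'
  obtain ⟨u', hu', h1, h2⟩ := wsos_mod f hf0 hu
  have h3 : f ∣ 1 + u' := by
    have := dvd_sub hdvd h1
    rwa [show 1 + u - (u - u') = 1 + u' by ring] at this
  obtain ⟨h, hh⟩ := h3
  have pos : ∀ z, 0 < f.eval z * h.eval z := by
    intro z
    rw [← eval_mul, ← hh, eval_add, eval_one]
    have := wsos_eval hu' z
    linarith
  have hne : h ≠ 0 := by rintro rfl; simpa using pos a
  have hdeg : h.natDegree < d := by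
    have e1 := natDegree_mul hf.ne_zero hne
    rw [← hh] at e1
    have e2 : (1 + u').natDegree ≤ 2 * (f.natDegree - 1) :=
      (natDegree_add_le _ _).trans (by simpa using h2)
    lia
  have hch : h.eval a * h.eval b < 0 := by
    have := mul_pos (pos a) (pos b)
    by_contra hc
    nlinarith [mul_nonneg (neg_nonneg.mpr hab.le) (not_lt.mp hc)]
  obtain ⟨k, hk1, hk2, hk3⟩ := exists_irr_factor h a b hch
  exact ih _ ((natDegree_le_of_dvd hk2 hne).trans_lt hdeg) k hk1 rfl a b hk3 u' hu'
    (hk2.trans (hh ▸ dvd_mul_left _ _))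

end Claim
end Polynomial.CP
end

section
open MvPolynomial
namespace Polynomial.CP
open scoped Polynomial
set_option linter.unusedSectionVars false

universe u

/-- Cone generated by `φ p * s²`. -/
def cone {A L : Type*} [CommRing A] [Field L] (P : Subsemiring A) (φ : A →+* L) (S : Subfield L) :
    AddSubmonoid L :=
  AddSubmonoid.closure {t | ∃ p ∈ P, ∃ s ∈ S, t = φ p * s ^ 2}

theorem exists_frac {A : Type u} [CommRing A] (P : Subsemiring A) (hsq : ∀ a, a * a ∈ P)
    (h1 : -1 ∉ P) : ∃ (K : Type u) (_ : Field K) (φ : A →+* K), -1 ∉ cone P φ ⊤ := by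
  obtain ⟨Q, hPQ, hQ1, hmax, htot⟩ := exists_maxPre P hsq h1
  have hprime := suppIdeal_prime Q htot hQ1 hmax
  set I := suppIdeal Q htot with hI
  have hmemI : ∀ a, a ∈ I ↔ a ∈ Q ∧ -a ∈ Q := fun a => Iff.rfl
  let K := FractionRing (A ⧸ I)
  let φ : A →+* K := (algebraMap (A ⧸ I) K).comp (Ideal.Quotient.mk I)
  have hφ : ∀ a, φ a = 0 ↔ a ∈ I := by
    intro a
    rw [← Ideal.Quotient.eq_zero_iff_mem]
    exact map_eq_zero_iff _ (IsFractionRing.injective (A ⧸ I) K)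
  refine ⟨K, inferInstance, φ, fun hcon => ?_⟩
  have key : ∀ t ∈ cone P φ ⊤, ∃ p ∈ Q, ∃ b, b ∉ I ∧ t * φ b ^ 2 = φ p := by
    intro t ht
    induction ht using AddSubmonoid.closure_induction with
    | mem x hx =>
      obtain ⟨p, hp, s, -, rfl⟩ := hx
      obtain ⟨a, b, hb, e⟩ := IsFractionRing.div_surjective (A := A ⧸ I) s
      obtain ⟨a, rfl⟩ := Ideal.Quotient.mk_surjective a
      obtain ⟨b, rfl⟩ := Ideal.Quotient.mk_surjective b
      have hb' : b ∉ I := by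
        rw [← Ideal.Quotient.eq_zero_iff_mem]
        exact nonZeroDivisors.ne_zero hb
      have hb'' : φ b ≠ 0 := fun h => hb' ((hφ b).mp h)
      have e' : φ a / φ b = s := e
      refine ⟨p * (a * a), Q.mul_mem (hPQ hp) (hPQ (hsq a)), b, hb', ?_⟩
      rw [← e', map_mul, map_mul, div_pow, mul_assoc, div_mul_cancel₀ _ (pow_ne_zero 2 hb''), sq]
    | zero => exact ⟨0, Q.zero_mem, 1, fun h => hQ1 h.2, by simp⟩
    | add x y _ _ hx hy =>
      obtain ⟨p, hp, b, hb, e⟩ := hx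
      obtain ⟨q, hq, c, hc, e'⟩ := hy
      refine ⟨p * (c * c) + q * (b * b), Q.add_mem (Q.mul_mem hp (hPQ (hsq c)))
        (Q.mul_mem hq (hPQ (hsq b))), b * c, fun h => (hprime.mem_or_mem h).elim hb hc, ?_⟩
      simp only [map_add, map_mul]
      linear_combination φ c ^ 2 * e + φ b ^ 2 * e'
  obtain ⟨p, hp, b, hb, e⟩ := key _ hcon
  have h2 : p + b * b ∈ I := by
    rw [← hφ, map_add, ← e, map_mul]; ring
  have h3 : b * b ∈ I := by
    refine ⟨hPQ (hsq b), ?_⟩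
    have := Q.add_mem h2.2 hp
    rwa [show -(p + b * b) + p = -(b * b) by ring] at this
  exact hb ((hprime.mem_or_mem h3).elim id id)

theorem cone_mono {A L : Type*} [CommRing A] [Field L] (P : Subsemiring A) (φ : A →+* L)
    {S S' : Subfield L} (h : S ≤ S') : cone P φ S ≤ cone P φ S' := by
  apply AddSubmonoid.closure_mono
  rintro t ⟨p, hp, s, hs, rfl⟩
  exact ⟨p, hp, s, h hs, rfl⟩

theorem cone_sSup {A L : Type*} [CommRing A] [Field L] (P : Subsemiring A) (φ : A →+* L)
    (c : Set (Subfield L)) (hne : c.Nonempty) (hc : IsChain (· ≤ ·) c) {t : L}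
    (ht : t ∈ cone P φ (sSup c)) : ∃ S ∈ c, t ∈ cone P φ S := by
  induction ht using AddSubmonoid.closure_induction with
  | mem x hx =>
    obtain ⟨p, hp, s, hs, rfl⟩ := hx
    rw [Subfield.mem_sSup_of_directedOn hne hc.directedOn] at hs
    obtain ⟨S, hS, hs⟩ := hs
    exact ⟨S, hS, AddSubmonoid.subset_closure ⟨p, hp, s, hs, rfl⟩⟩
  | zero => obtain ⟨S, hS⟩ := hne; exact ⟨S, hS, zero_mem _⟩
  | add x y _ _ hx hy =>
    obtain ⟨S, hS, h1⟩ := hx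
    obtain ⟨S', hS', h2⟩ := hy
    rcases hc.total hS hS' with h | h
    · exact ⟨S', hS', add_mem (cone_mono P φ h h1) h2⟩
    · exact ⟨S, hS, add_mem h1 (cone_mono P φ h h2)⟩

/-- The cone as a subsemiring of `S`. -/
def conePre {A L : Type*} [CommRing A] [Field L] (P : Subsemiring A) (φ : A →+* L)
    (S : Subfield L) : Subsemiring S where
  carrier := {s | (s : L) ∈ cone P φ S}
  zero_mem' := zero_mem (cone P φ S)
  add_mem' := fun h1 h2 => (cone P φ S).add_mem h1 h2
  one_mem' := AddSubmonoid.subset_closure ⟨1, P.one_mem, 1, S.one_mem, by simp⟩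
  mul_mem' := by
    rintro ⟨a, ha'⟩ ⟨b, hb'⟩ ha hb
    change a * b ∈ cone P φ S
    change a ∈ cone P φ S at ha
    change b ∈ cone P φ S at hb
    clear ha' hb'
    induction ha using AddSubmonoid.closure_induction with
    | mem x hx =>
      obtain ⟨p, hp, s, hs, rfl⟩ := hx
      induction hb using AddSubmonoid.closure_induction with
      | mem y hy =>
        obtain ⟨q, hq, r, hr, rfl⟩ := hy
        exact AddSubmonoid.subset_closure ⟨p * q, P.mul_mem hp hq, s * r, S.mul_mem hs hr,
          by rw [map_mul]; ring⟩
      | zero => rw [mul_zero]; exact zero_mem _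
      | add x y _ _ hx hy => rw [mul_add]; exact add_mem hx hy
    | zero => rw [zero_mul]; exact zero_mem _
    | add x y _ _ hx hy => rw [add_mul]; exact add_mem hx hy

theorem real_closed_ext {A : Type u} [CommRing A] (P : Subsemiring A) (hsq : ∀ a, a * a ∈ P)
    (h1 : -1 ∉ P) : ∃ (S : Type u) (_ : Field S) (_ : LinearOrder S) (_ : IsStrictOrderedRing S)
      (φ : A →+* S), (∀ p ∈ P, 0 ≤ φ p) ∧ PolyIVT S := by
  obtain ⟨K, _, φ₀, hφ₀⟩ := exists_frac P hsq h1
  let L := AlgebraicClosure K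
  let i : K →+* L := algebraMap K L
  let φ : A →+* L := i.comp φ₀
  have h0 : -1 ∉ cone P φ i.fieldRange := by
    intro hcon
    have key : ∀ t ∈ cone P φ i.fieldRange, ∃ t' ∈ cone P φ₀ ⊤, t = i t' := by
      intro t ht
      induction ht using AddSubmonoid.closure_induction with
      | mem x hx =>
        obtain ⟨p, hp, s, ⟨s', rfl⟩, rfl⟩ := hx
        exact ⟨φ₀ p * s' ^ 2, AddSubmonoid.subset_closure ⟨p, hp, s', trivial, rfl⟩, by
          rw [map_mul, map_pow]; rfl⟩
      | zero => exact ⟨0, zero_mem _, by simp⟩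
      | add x y _ _ hx hy =>
        obtain ⟨x', hx', rfl⟩ := hx
        obtain ⟨y', hy', rfl⟩ := hy
        exact ⟨x' + y', add_mem hx' hy', by simp⟩
    obtain ⟨t', ht', e⟩ := key _ hcon
    have : t' = -1 := by
      apply i.injective
      rw [← e, map_neg, map_one]
    exact hφ₀ (this ▸ ht')
  obtain ⟨S, hS0, hS⟩ := zorn_le_nonempty₀ {S : Subfield L | -1 ∉ cone P φ S} (by
    intro c hc hch y hy
    refine ⟨sSup c, ?_, fun z hz => le_sSup hz⟩
    intro hcon
    obtain ⟨S, hS, h⟩ := cone_sSup P φ c ⟨y, hy⟩ hch hcon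
    exact hc hS h) _ h0
  have hφS : ∀ a, φ a ∈ S := fun a => hS0 ⟨φ₀ a, rfl⟩
  let φS : A →+* S := φ.codRestrict S hφS
  obtain ⟨_, _, hord⟩ := exists_order (conePre P φ S)
    (fun a => show ((a * a : S) : L) ∈ cone P φ S from
      AddSubmonoid.subset_closure ⟨1, P.one_mem, a, a.2, by
      rw [map_one, one_mul, sq]; rfl⟩)
    (by
      intro h
      apply hS.1
      have h' : ((-1 : S) : L) ∈ cone P φ S := h
      simpa using h')
  have hpos : ∀ p ∈ P, 0 ≤ φS p := fun p hp => hord _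
    (show ((φS p : S) : L) ∈ cone P φ S from AddSubmonoid.subset_closure ⟨p, hp, 1, S.one_mem, by rw [one_pow, mul_one]; rfl⟩)
  refine ⟨S, inferInstance, inferInstance, inferInstance, φS, hpos, ?_⟩
  intro p a b hab hpa hpb
  rcases hpa.eq_or_lt with h | hpa
  · exact ⟨a, le_rfl, hab, h⟩
  rcases hpb.eq_or_lt with h | hpb
  · exact ⟨b, hab, le_rfl, h.symm⟩
  obtain ⟨f, hf, hfp, hfab⟩ := exists_irr_factor p a b (mul_neg_of_neg_of_pos hpa hpb)
  obtain ⟨α, hα⟩ := IsAlgClosed.exists_aeval_eq_zero (k := L) f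
    (by rw [degree_eq_natDegree hf.ne_zero]; exact_mod_cast hf.natDegree_pos.ne')
  have hIntegral : IsIntegral S α := by
    rw [← isAlgebraic_iff_isIntegral]
    exact ⟨f, hf.ne_zero, hα⟩
  let E := (IntermediateField.adjoin S {α}).toSubfield
  have hSE : S ≤ E := fun s hs => (IntermediateField.adjoin S {α}).algebraMap_mem ⟨s, hs⟩
  have hE : -1 ∉ cone P φ E := by
    intro hcon
    have key : ∀ t ∈ cone P φ E, ∃ w ∈ wsos S, t = aeval α w := by
      intro t ht
      induction ht using AddSubmonoid.closure_induction with
      | mem x hx =>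
        obtain ⟨q, hq, s, hs, rfl⟩ := hx
        have hs' : s ∈ (IntermediateField.adjoin S {α}).toSubalgebra := hs
        rw [IntermediateField.adjoin_simple_toSubalgebra_of_isAlgebraic hIntegral.isAlgebraic,
          Algebra.adjoin_singleton_eq_range_aeval] at hs'
        obtain ⟨r, rfl⟩ := hs'
        refine ⟨C (φS q) * r ^ 2, AddSubmonoid.subset_closure ⟨_, r, hpos q hq, rfl⟩, ?_⟩
        rw [map_mul, map_pow, aeval_C]
        rfl
      | zero => exact ⟨0, zero_mem _, by simp⟩
      | add x y _ _ hx hy =>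
        obtain ⟨x', hx', rfl⟩ := hx
        obtain ⟨y', hy', rfl⟩ := hy
        exact ⟨x' + y', add_mem hx' hy', by simp⟩
    obtain ⟨w, hw, e⟩ := key _ hcon
    refine irr_claim _ f hf rfl a b hfab w hw ?_
    by_contra hnd
    obtain ⟨c, d, hcd⟩ := (hf.coprime_iff_not_dvd).mpr hnd
    have := congrArg (aeval α) hcd
    simp [hα, ← e] at this
  have hES : E ≤ S := hS.2 (y := E) hE hSE
  have hαS : α ∈ S := hES (IntermediateField.mem_adjoin_simple_self S α)
  have hroot : f.eval (⟨α, hαS⟩ : S) = 0 := by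
    have : aeval (algebraMap S L ⟨α, hαS⟩) f = 0 := hα
    rw [aeval_algebraMap_apply] at this
    simpa [aeval_def] using this
  obtain ⟨q, hq⟩ := dvd_iff_isRoot.mpr hroot
  have hqu : IsUnit q := (hf.isUnit_or_isUnit hq).resolve_left (not_isUnit_X_sub_C _)
  obtain ⟨r, -, rfl⟩ := Polynomial.isUnit_iff.mp hqu
  refine ⟨⟨α, hαS⟩, ?_⟩
  generalize (⟨α, hαS⟩ : S) = β at *
  rw [hq] at hfab
  simp only [eval_mul, eval_sub, eval_X, eval_C] at hfab
  have h5 : (a - β) * (b - β) < 0 := by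
    by_contra h6
    have := mul_nonneg (not_lt.mp h6) (mul_self_nonneg r)
    nlinarith
  have hβ : p.eval β = 0 := by
    obtain ⟨w, rfl⟩ := hfp
    rw [eval_mul, hroot, zero_mul]
  rcases mul_neg_iff.mp h5 with ⟨h7, h8⟩ | ⟨h7, h8⟩
  · linarith
  · exact ⟨by linarith, by linarith, hβ⟩

end Polynomial.CP
end

section
open MvPolynomial
namespace CPM
set_option linter.unusedSectionVars false

section Krivine
variable {A : Type*} [CommRing A] [Algebra ℝ A]


theorem krivine_point (T : Subsemiring A) (hC : ∀ r : ℝ, 0 ≤ r → (algebraMap ℝ A) r ∈ T)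
    (harch : ∀ a : A, ∃ N : ℝ, (algebraMap ℝ A) N - a ∈ T) (M₀ : Submodule T A) (h1 : (1 : A) ∈ M₀)
    (hM₀ : (-1 : A) ∉ M₀) :
    ∃ x : A →+* ℝ, (∀ r, x ((algebraMap ℝ A) r) = r) ∧ ∀ a ∈ M₀, 0 ≤ x a := by
  obtain ⟨M, hM0, hM⟩ := zorn_le_nonempty₀ {M : Submodule T A | M₀ ≤ M ∧ (-1 : A) ∉ M} (by
    intro c hc hch y hy
    refine ⟨sSup c, ⟨(hc hy).1.trans (le_sSup hy), ?_⟩, fun z hz => le_sSup hz⟩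
    rw [Submodule.mem_sSup_of_directed ⟨y, hy⟩ hch.directedOn]
    rintro ⟨s, hs, h⟩
    exact (hc hs).2 h) M₀ ⟨le_rfl, hM₀⟩
  have hneg1 := hM.1.2
  have hmul : ∀ t ∈ T, ∀ m ∈ M, t * m ∈ M := fun t ht m hm => M.smul_mem ⟨t, ht⟩ hm
  have hTM : ∀ t ∈ T, t ∈ M := fun t ht => by
    have := hmul t ht 1 (hM0 h1); rwa [mul_one] at this
  have key : ∀ a, a ∉ M → ∃ m ∈ M, ∃ t ∈ T, -1 = m + t * a := by
    intro a ha
    by_contra hcon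
    have hle : M ≤ M ⊔ Submodule.span T {a} := le_sup_left
    have := hM.2 (y := M ⊔ Submodule.span T {a}) ⟨hM0.trans hle, by
      intro h
      rw [Submodule.mem_sup] at h
      obtain ⟨m, hm, z, hz, e⟩ := h
      obtain ⟨t, rfl⟩ := Submodule.mem_span_singleton.mp hz
      exact hcon ⟨m, hm, t, t.2, e.symm⟩⟩ hle
    exact ha (this (Submodule.mem_sup_right (Submodule.mem_span_singleton_self a)))
  have htot : ∀ a, a ∈ M ∨ -a ∈ M := by
    intro a
    by_contra hcon
    push Not at hcon
    obtain ⟨m, hm, t, ht, e⟩ := key a hcon.1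
    obtain ⟨m', hm', t', ht', e'⟩ := key _ hcon.2
    have h2 : -t ∈ M := by
      have : -t = t' + t * m' + t' * m := by linear_combination t * e' + t' * e
      rw [this]
      exact M.add_mem (M.add_mem (hTM t' ht') (hmul _ ht _ hm')) (hmul _ ht' _ hm)
    obtain ⟨N, hN⟩ := harch a
    obtain ⟨N', hN'0, hN'⟩ : ∃ N' : ℝ, 0 ≤ N' ∧ (algebraMap ℝ A) N' - a ∈ T := by
      refine ⟨max N 0, le_max_right _ _, ?_⟩
      have := T.add_mem hN (hC (max N 0 - N) (by simp))
      rw [map_sub] at this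
      convert this using 1; ring
    apply hneg1
    have : (-1 : A) = m + (((algebraMap ℝ A) N' - a) * (-t) + t * (algebraMap ℝ A) N') := by linear_combination e
    rw [this]
    exact M.add_mem hm (M.add_mem (hmul _ hN' _ h2) (hTM _ (T.mul_mem ht (hC _ hN'0))))
  have hconst : ∀ r : ℝ, (algebraMap ℝ A) r ∈ M → 0 ≤ r := by
    intro r hr
    by_contra h
    push Not at h
    apply hneg1
    have := hmul ((algebraMap ℝ A) (-r)⁻¹) (hC _ (by rw [inv_nonneg]; linarith)) _ hr
    rw [← map_mul] at this
    have e : (-r)⁻¹ * r = -1 := by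
      rw [inv_neg, neg_mul, inv_mul_cancel₀ h.ne]
    rw [e, map_neg, map_one] at this
    exact this
  let I : A → ℝ → Prop := fun a c => ∀ ε : ℝ, 0 < ε → a - (algebraMap ℝ A) c + (algebraMap ℝ A) ε ∈ M ∧ (algebraMap ℝ A) c - a + (algebraMap ℝ A) ε ∈ M
  have Iuniq : ∀ a c d, I a c → I a d → c ≤ d := by
    intro a c d h1 h2
    apply le_of_forall_pos_le_add
    intro ε hε
    have := M.add_mem (h1 (ε/2) (by positivity)).1 (h2 (ε/2) (by positivity)).2
    have h3 : 0 ≤ d + ε - c := by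
      apply hconst
      convert this using 1
      rw [map_sub, map_add, show ε = ε / 2 + ε / 2 by ring, map_add]
      simp only [add_halves]; ring
    linarith
  have Iadd : ∀ a b c d, I a c → I b d → I (a + b) (c + d) := by
    intro a b c d h1 h2 ε hε
    have e : (algebraMap ℝ A) ε = (algebraMap ℝ A) (ε / 2) + (algebraMap ℝ A) (ε / 2) := by rw [← map_add, add_halves]
    refine ⟨?_, ?_⟩
    · convert M.add_mem (h1 (ε/2) (by positivity)).1 (h2 (ε/2) (by positivity)).1 using 1
      rw [e, map_add]; ring
    · convert M.add_mem (h1 (ε/2) (by positivity)).2 (h2 (ε/2) (by positivity)).2 using 1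
      rw [e, map_add]; ring
  have Ineg : ∀ a c, I a c → I (-a) (-c) := by
    intro a c h ε hε
    refine ⟨?_, ?_⟩
    · convert (h ε hε).2 using 1
      rw [map_neg]; ring
    · convert (h ε hε).1 using 1
      rw [map_neg]; ring
  have Iconst : ∀ r, I ((algebraMap ℝ A) r) r := by
    intro r ε hε
    rw [sub_self, zero_add]
    exact ⟨hTM _ (hC _ hε.le), hTM _ (hC _ hε.le)⟩
  have Imul0 : ∀ t ∈ T, ∀ a, I a 0 → I (t * a) 0 := by
    intro t ht a h ε hε
    obtain ⟨N, hN⟩ := harch t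
    obtain ⟨N', hN'0, hN'⟩ : ∃ N' : ℝ, 0 < N' ∧ (algebraMap ℝ A) N' - t ∈ T := by
      refine ⟨max N 1, by positivity, ?_⟩
      have := T.add_mem hN (hC (max N 1 - N) (by simp))
      rw [map_sub] at this
      convert this using 1; ring
    have hd : 0 < ε / N' := by positivity
    have e : (algebraMap ℝ A) ε = (algebraMap ℝ A) (ε / N') * (algebraMap ℝ A) N' := by rw [← map_mul, div_mul_cancel₀ _ hN'0.ne']
    have h3 := hTM _ (T.mul_mem (hC _ hd.le) hN')
    refine ⟨?_, ?_⟩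
    · convert M.add_mem (hmul t ht _ (h _ hd).1) h3 using 1
      rw [e, map_zero]; ring
    · convert M.add_mem (hmul t ht _ (h _ hd).2) h3 using 1
      rw [e, map_zero]; ring
  have Isub : ∀ a b c d, I a c → I b d → I (a - b) (c - d) := by
    intro a b c d h1 h2
    rw [sub_eq_add_neg, sub_eq_add_neg]
    exact Iadd _ _ _ _ h1 (Ineg _ _ h2)
  have Iscal0 : ∀ r : ℝ, 0 ≤ r → ∀ a c, I a c → I ((algebraMap ℝ A) r * a) (r * c) := by
    intro r hr a c h
    have h2 := Isub _ _ _ _ h (Iconst c)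
    rw [sub_self] at h2
    have h3 := Iadd _ _ _ _ (Imul0 _ (hC r hr) _ h2) (Iconst (r * c))
    convert h3 using 1
    · rw [map_mul]; ring
    · ring
  have Iscal : ∀ r : ℝ, ∀ a c, I a c → I ((algebraMap ℝ A) r * a) (r * c) := by
    intro r a c h
    rcases le_total 0 r with hr | hr
    · exact Iscal0 r hr a c h
    · convert Ineg _ _ (Iscal0 (-r) (by linarith) a c h) using 1
      · rw [map_neg]; ring
      · ring
  have ImulT : ∀ t ∈ T, ∀ a c d, I t d → I a c → I (t * a) (d * c) := by
    intro t ht a c d htd h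
    have h2 := Isub _ _ _ _ h (Iconst c)
    rw [sub_self] at h2
    have h3 := Iadd _ _ _ _ (Imul0 t ht _ h2) (Iscal c t d htd)
    convert h3 using 1 <;> ring
  have Imul : ∀ a b c d, I a c → I b d → I (a * b) (c * d) := by
    intro a b c d h1 h2
    obtain ⟨N, hN⟩ := harch (-a)
    have h3 := ImulT _ hN b d _ (Isub _ _ _ _ (Iconst N) (Ineg _ _ h1)) h2
    have h4 := Isub _ _ _ _ h3 (Iscal N b d h2)
    convert h4 using 1 <;> ring
  have Iex : ∀ a, ∃ c, I a c := by
    intro a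
    have hne : {r : ℝ | a - (algebraMap ℝ A) r ∈ M}.Nonempty := by
      obtain ⟨N, hN⟩ := harch (-a)
      refine ⟨-N, ?_⟩
      have := hTM _ hN
      change _ ∈ M
      convert this using 1
      rw [map_neg]; ring
    have hbdd : BddAbove {r : ℝ | a - (algebraMap ℝ A) r ∈ M} := by
      obtain ⟨N, hN⟩ := harch a
      refine ⟨N, fun r hr => ?_⟩
      have hr' : a - (algebraMap ℝ A) r ∈ M := hr
      have := hconst (N - r) (by
        convert M.add_mem hr' (hTM _ hN) using 1
        rw [map_sub]; ring)
      linarith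
    refine ⟨sSup {r : ℝ | a - (algebraMap ℝ A) r ∈ M}, fun ε hε => ⟨?_, ?_⟩⟩
    · obtain ⟨r, hr, hlt⟩ := exists_lt_of_lt_csSup hne (b := sSup {r : ℝ | a - (algebraMap ℝ A) r ∈ M} - ε)
        (by linarith)
      have hr' : a - (algebraMap ℝ A) r ∈ M := hr
      convert M.add_mem hr' (hTM _ (hC (r - (sSup {r : ℝ | a - (algebraMap ℝ A) r ∈ M} - ε)) (by linarith))) using 1
      rw [map_sub, map_sub]; ring
    · have h : sSup {r : ℝ | a - (algebraMap ℝ A) r ∈ M} + ε ∉ {r : ℝ | a - (algebraMap ℝ A) r ∈ M} := by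
        intro h
        have := le_csSup hbdd h
        linarith
      have h' : a - (algebraMap ℝ A) (sSup {r : ℝ | a - (algebraMap ℝ A) r ∈ M} + ε) ∉ M := h
      have := (htot _).resolve_left h'
      convert this using 1
      rw [map_add]; ring
  choose x hx using Iex
  have xu : ∀ a c, I a c → x a = c := fun a c h =>
    le_antisymm (Iuniq _ _ _ (hx a) h) (Iuniq _ _ _ h (hx a))
  refine ⟨{ toFun := x
            map_one' := xu _ _ (by simpa using Iconst 1)
            map_zero' := xu _ _ (by simpa using Iconst 0)
            map_mul' := fun a b => xu _ _ (Imul _ _ _ _ (hx a) (hx b))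
            map_add' := fun a b => xu _ _ (Iadd _ _ _ _ (hx a) (hx b)) },
    fun r => xu _ _ (Iconst r), fun a ha => ?_⟩
  change 0 ≤ x a
  apply le_of_forall_pos_le_add
  intro ε hε
  apply hconst
  convert M.add_mem (hM0 ha) (hx a ε hε).2 using 1
  rw [map_add]; ring

/-- Krivine's theorem for archimedean semirings. -/
theorem krivine (T : Subsemiring A) (hC : ∀ r : ℝ, 0 ≤ r → (algebraMap ℝ A) r ∈ T)
    (harch : ∀ a : A, ∃ N : ℝ, (algebraMap ℝ A) N - a ∈ T) (f : A)
    (hf : ∀ x : A →+* ℝ, (∀ r, x ((algebraMap ℝ A) r) = r) → (∀ t ∈ T, 0 ≤ x t) → 0 < x f) : f ∈ T := by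
  obtain ⟨t, ht, t', ht', e⟩ : ∃ t ∈ T, ∃ t' ∈ T, (-1 : A) = t - f * t' := by
    by_contra hcon
    let M : Submodule T A := Submodule.span T {1, -f}
    have hM : ∀ a, a ∈ M ↔ ∃ t ∈ T, ∃ t' ∈ T, a = t - f * t' := by
      intro a
      rw [Submodule.mem_span_pair]
      constructor
      · rintro ⟨t, t', rfl⟩
        refine ⟨t, t.2, t', t'.2, ?_⟩
        rw [Subsemiring.smul_def, Subsemiring.smul_def, smul_eq_mul, smul_eq_mul]; ring
      · rintro ⟨t, ht, t', ht', rfl⟩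
        refine ⟨⟨t, ht⟩, ⟨t', ht'⟩, ?_⟩
        rw [Subsemiring.smul_def, Subsemiring.smul_def, smul_eq_mul, smul_eq_mul]; ring
    obtain ⟨x, hx1, hx2⟩ := krivine_point T hC harch M
      ((hM 1).mpr ⟨1, T.one_mem, 0, T.zero_mem, by ring⟩) (fun h => hcon ((hM _).mp h))
    have h1 := hf x hx1 (fun t ht => hx2 t ((hM t).mpr ⟨t, ht, 0, T.zero_mem, by ring⟩))
    have h2 := hx2 (-f) ((hM _).mpr ⟨0, T.zero_mem, 1, T.one_mem, by ring⟩)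
    rw [map_neg] at h2
    linarith
  obtain ⟨N, hN0, hN⟩ : ∃ N : ℝ, 0 < N ∧ (algebraMap ℝ A) N - t' ∈ T := by
    obtain ⟨N, hN⟩ := harch t'
    refine ⟨max N 1, by positivity, ?_⟩
    have := T.add_mem hN (hC (max N 1 - N) (by simp))
    rw [map_sub] at this
    convert this using 1; ring
  have step : ∀ r : ℝ, 0 ≤ r → f + (algebraMap ℝ A) r ∈ T → f + (algebraMap ℝ A) (r - N⁻¹) ∈ T := by
    intro r hr h
    have h1 : (algebraMap ℝ A) N⁻¹ * (((algebraMap ℝ A) N - t') * (f + (algebraMap ℝ A) r) + t + t' * (algebraMap ℝ A) r) ∈ T :=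
      T.mul_mem (hC _ (by positivity)) (T.add_mem (T.add_mem (T.mul_mem hN h) ht)
        (T.mul_mem ht' (hC _ hr)))
    convert h1 using 1
    have e2 : (algebraMap ℝ A) N⁻¹ * (algebraMap ℝ A) N = 1 := by rw [← map_mul, inv_mul_cancel₀ hN0.ne', map_one]
    rw [map_sub]
    linear_combination (-f - (algebraMap ℝ A) r) * e2 + (algebraMap ℝ A) N⁻¹ * e
  obtain ⟨r₀, hr₀⟩ := harch (-f)
  have hr₁ : f + (algebraMap ℝ A) r₀ ∈ T := by
    convert hr₀ using 1; ring
  have iter : ∀ k : ℕ, f + (algebraMap ℝ A) (r₀ - k * N⁻¹) ∈ T ∨ f ∈ T := by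
    intro k
    induction k with
    | zero => left; simpa using hr₁
    | succ k ih =>
      rcases ih with ih | ih
      · by_cases h : 0 ≤ r₀ - k * N⁻¹
        · left
          have := step _ h ih
          convert this using 3
          push_cast; ring
        · right
          have := T.add_mem ih (hC (-(r₀ - k * N⁻¹)) (by linarith))
          rw [map_neg] at this
          convert this using 1; ring
      · exact Or.inr ih
  obtain ⟨k, hk⟩ := exists_nat_gt (r₀ * N)
  rcases iter k with h | h
  · have h2 : r₀ ≤ k * N⁻¹ := by
      rw [← div_eq_mul_inv, le_div_iff₀ hN0]; exact hk.le
    have := T.add_mem h (hC (-(r₀ - k * N⁻¹)) (by linarith))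
    rw [map_neg] at this
    convert this using 1; ring
  · exact h

end Krivine

theorem arch_of_gen {σ : Type*} (T : Subsemiring (MvPolynomial σ ℝ))
    (hC : ∀ r : ℝ, 0 ≤ r → C r ∈ T)
    (hX : ∀ i, ∃ N : ℝ, C N - X i ∈ T ∧ C N + X i ∈ T) (a : MvPolynomial σ ℝ) :
    ∃ N : ℝ, C N - a ∈ T := by
  have mul : ∀ a b : MvPolynomial σ ℝ, (∃ N : ℝ, C N - a ∈ T ∧ C N + a ∈ T) →
      (∃ N : ℝ, C N - b ∈ T ∧ C N + b ∈ T) → (∃ N : ℝ, C N - a * b ∈ T ∧ C N + a * b ∈ T) := by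
    rintro a b ⟨N, h1, h2⟩ ⟨M, h3, h4⟩
    have e : (C (2⁻¹ : ℝ) : MvPolynomial σ ℝ) * 2 = 1 := by
      rw [← map_ofNat C 2, ← C_mul]; norm_num
    refine ⟨N * M, ?_, ?_⟩
    · convert T.mul_mem (hC 2⁻¹ (by norm_num)) (T.add_mem (T.mul_mem h1 h4) (T.mul_mem h2 h3)) using 1
      rw [C_mul]
      linear_combination (a * b - C N * C M) * e
    · convert T.mul_mem (hC 2⁻¹ (by norm_num)) (T.add_mem (T.mul_mem h2 h4) (T.mul_mem h1 h3)) using 1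
      rw [C_mul]
      linear_combination (- a * b - C N * C M) * e
  have : ∃ N : ℝ, C N - a ∈ T ∧ C N + a ∈ T := by
    induction a using MvPolynomial.induction_on with
    | C r =>
      refine ⟨|r|, ?_, ?_⟩
      · rw [← C_sub]; exact hC _ (by linarith [le_abs_self r])
      · rw [← C_add]; exact hC _ (by linarith [neg_abs_le r])
    | add p q hp hq =>
      obtain ⟨N, h1, h2⟩ := hp
      obtain ⟨M, h3, h4⟩ := hq
      refine ⟨N + M, ?_, ?_⟩
      · convert T.add_mem h1 h3 using 1; rw [C_add]; ring
      · convert T.add_mem h2 h4 using 1; rw [C_add]; ring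
    | mul_X p i hp => exact mul _ _ hp (hX i)
  obtain ⟨N, h, -⟩ := this
  exact ⟨N, h⟩

theorem krivine_mv {σ : Type*} (T : Subsemiring (MvPolynomial σ ℝ))
    (hC : ∀ r : ℝ, 0 ≤ r → C r ∈ T)
    (hX : ∀ i, ∃ N : ℝ, C N - X i ∈ T ∧ C N + X i ∈ T) (f : MvPolynomial σ ℝ)
    (hf : ∀ x : σ → ℝ, (∀ t ∈ T, 0 ≤ eval x t) → 0 < eval x f) : f ∈ T := by
  refine krivine T hC (arch_of_gen T hC hX) f ?_
  intro x hx hT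
  have : x = eval (fun i => x (X i)) := by
    apply MvPolynomial.ringHom_ext
    · intro r
      rw [eval_C]; exact hx r
    · intro i; rw [eval_X]
  rw [this]
  rw [this] at hT
  exact hf _ hT

end CPM
end

section
open MvPolynomial
namespace CPM
set_option linter.unusedSectionVars false

theorem isSOS_iff {ι : Type*} (q : MvPolynomial ι ℝ) : IsSOS q ↔ IsSumSq q := by
  constructor
  · rintro ⟨k, s, rfl⟩
    apply IsSumSq.sum
    intro i _
    rw [sq]; exact IsSumSq.mul_self _
  · intro h
    induction h with
    | zero => exact ⟨0, Fin.elim0, by simp⟩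
    | sq_add a hs ih =>
      obtain ⟨k, s, rfl⟩ := ih
      exact ⟨k + 1, Fin.cons a s, by rw [Fin.sum_univ_succ]; simp [sq]⟩

theorem IsSOS.add' {ι : Type*} {p q : MvPolynomial ι ℝ} (hp : IsSOS p) (hq : IsSOS q) :
    IsSOS (p + q) := by
  rw [isSOS_iff] at *; exact hp.add hq

theorem IsSOS.mul' {ι : Type*} {p q : MvPolynomial ι ℝ} (hp : IsSOS p) (hq : IsSOS q) :
    IsSOS (p * q) := by
  rw [isSOS_iff] at *; exact hp.mul hq

theorem IsSOS.zero' {ι : Type*} : IsSOS (0 : MvPolynomial ι ℝ) := by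
  rw [isSOS_iff]; exact IsSumSq.zero

theorem IsSOS.sq' {ι : Type*} (p : MvPolynomial ι ℝ) : IsSOS (p ^ 2) := by
  rw [isSOS_iff, sq]; exact IsSumSq.mul_self _

theorem IsSOS.const {ι : Type*} {r : ℝ} (hr : 0 ≤ r) : IsSOS (C r : MvPolynomial ι ℝ) := by
  have : (C r : MvPolynomial ι ℝ) = C (√r) ^ 2 := by
    rw [← C_pow, Real.sq_sqrt hr]
  rw [this]; exact IsSOS.sq' _

theorem IsSOS.one' {ι : Type*} : IsSOS (1 : MvPolynomial ι ℝ) := by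
  simpa using IsSOS.const (ι := ι) zero_le_one

theorem IsSOS.sum' {ι α : Type*} (s : Finset α) (f : α → MvPolynomial ι ℝ)
    (h : ∀ i ∈ s, IsSOS (f i)) : IsSOS (∑ i ∈ s, f i) := by
  rw [isSOS_iff]
  exact IsSumSq.sum fun i hi => (isSOS_iff _).mp (h i hi)

section Q
variable {ι κ : Type*} [Fintype κ] {h : κ → MvPolynomial ι ℝ}

theorem Q.add {p q : MvPolynomial ι ℝ} (hp : InQuadraticModule h p) (hq : InQuadraticModule h q) :
    InQuadraticModule h (p + q) := by
  obtain ⟨c₀, c, h1, h2, rfl⟩ := hp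
  obtain ⟨d₀, d, h3, h4, rfl⟩ := hq
  refine ⟨c₀ + d₀, fun j => c j + d j, IsSOS.add' h1 h3, fun j => IsSOS.add' (h2 j) (h4 j), ?_⟩
  simp only [add_mul, Finset.sum_add_distrib]; ring

theorem Q.of_sos {p : MvPolynomial ι ℝ} (hp : IsSOS p) : InQuadraticModule h p :=
  ⟨p, 0, hp, fun _ => IsSOS.zero', by simp⟩

theorem Q.gen (j : κ) : InQuadraticModule h (h j) := by
  classical
  refine ⟨0, Pi.single j 1, IsSOS.zero', fun i => ?_, ?_⟩
  · by_cases e : i = j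
    · subst e; simpa using IsSOS.one'
    · simpa [Pi.single_apply, e] using IsSOS.zero'
  · simp [Pi.single_apply]

theorem Q.sos_mul {s p : MvPolynomial ι ℝ} (hs : IsSOS s) (hp : InQuadraticModule h p) :
    InQuadraticModule h (s * p) := by
  obtain ⟨c₀, c, h1, h2, rfl⟩ := hp
  refine ⟨s * c₀, fun j => s * c j, IsSOS.mul' hs h1, fun j => IsSOS.mul' hs (h2 j), ?_⟩
  rw [mul_add, Finset.mul_sum]
  simp only [mul_assoc]

theorem Q.sum {α : Type*} (s : Finset α) (f : α → MvPolynomial ι ℝ)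
    (hf : ∀ i ∈ s, InQuadraticModule h (f i)) : InQuadraticModule h (∑ i ∈ s, f i) := by
  classical
  induction s using Finset.induction_on with
  | empty => simpa using Q.of_sos IsSOS.zero'
  | insert a s ha ih =>
    rw [Finset.sum_insert ha]
    exact Q.add (hf _ (by simp)) (ih fun i hi => hf i (by simp [hi]))
end Q

section Pre
variable {ι κ : Type*} [Fintype κ] [DecidableEq κ] {g : κ → MvPolynomial ι ℝ}

theorem P.add {p q : MvPolynomial ι ℝ} (hp : InPreordering g p) (hq : InPreordering g q) :
    InPreordering g (p + q) := by
  obtain ⟨c, h1, rfl⟩ := hp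
  obtain ⟨d, h3, rfl⟩ := hq
  refine ⟨fun j => c j + d j, fun j => IsSOS.add' (h1 j) (h3 j), ?_⟩
  simp only [add_mul, Finset.sum_add_distrib]

theorem P.single (J : Finset κ) {s : MvPolynomial ι ℝ} (hs : IsSOS s) :
    InPreordering g (s * ∏ j ∈ J, g j) := by
  refine ⟨Pi.single J s, fun i => ?_, ?_⟩
  · by_cases e : i = J
    · subst e; simpa using hs
    · simpa [Pi.single_apply, e] using IsSOS.zero'
  · simp [Pi.single_apply]

theorem P.zero : InPreordering g 0 := by
  simpa using P.single (g := g) ∅ IsSOS.zero'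

theorem P.sum {α : Type*} (s : Finset α) (f : α → MvPolynomial ι ℝ)
    (hf : ∀ i ∈ s, InPreordering g (f i)) : InPreordering g (∑ i ∈ s, f i) := by
  classical
  induction s using Finset.induction_on with
  | empty => simpa using P.zero
  | insert a s ha ih =>
    rw [Finset.sum_insert ha]
    exact P.add (hf _ (by simp)) (ih fun i hi => hf i (by simp [hi]))

theorem P.gen_mul (j : κ) {p : MvPolynomial ι ℝ} (hp : InPreordering g p) :
    InPreordering g (g j * p) := by
  obtain ⟨c, h1, rfl⟩ := hp
  rw [Finset.mul_sum]
  apply P.sum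
  intro J _
  by_cases hj : j ∈ J
  · rw [← Finset.mul_prod_erase J g hj]
    have := P.single (g := g) (J.erase j) (IsSOS.mul' (h1 J) (IsSOS.sq' (g j)))
    convert this using 1; ring
  · have := P.single (g := g) (insert j J) (h1 J)
    rw [Finset.prod_insert hj] at this
    convert this using 1; ring

theorem P.sq_mul (s : MvPolynomial ι ℝ) {p : MvPolynomial ι ℝ} (hp : InPreordering g p) :
    InPreordering g (s ^ 2 * p) := by
  obtain ⟨c, h1, rfl⟩ := hp
  refine ⟨fun J => s ^ 2 * c J, fun J => IsSOS.mul' (IsSOS.sq' s) (h1 J), ?_⟩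
  rw [Finset.mul_sum]
  simp only [mul_assoc]

/-- The preordering as a semiring. -/
noncomputable def preo (g : κ → MvPolynomial ι ℝ) : Subsemiring (MvPolynomial ι ℝ) :=
  Subsemiring.closure (Set.range g ∪ Set.range (fun s => s ^ 2))

theorem preo_gen (j : κ) : g j ∈ preo g := Subsemiring.subset_closure (Or.inl ⟨j, rfl⟩)

theorem preo_sq (s : MvPolynomial ι ℝ) : s ^ 2 ∈ preo g :=
  Subsemiring.subset_closure (Or.inr ⟨s, rfl⟩)

theorem preo_sos {s : MvPolynomial ι ℝ} (h : IsSOS s) : s ∈ preo g := by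
  obtain ⟨k, t, rfl⟩ := h
  exact sum_mem fun i _ => preo_sq _

theorem preo_const {r : ℝ} (h : 0 ≤ r) : C r ∈ preo g := preo_sos (IsSOS.const h)

theorem preo_iff {p : MvPolynomial ι ℝ} : p ∈ preo g ↔ InPreordering g p := by
  constructor
  · intro hp
    have key : ∀ σ, InPreordering g σ → InPreordering g (p * σ) := by
      induction hp using Subsemiring.closure_induction with
      | mem x hx =>
        intro σ hσ
        rcases hx with ⟨j, rfl⟩ | ⟨s, rfl⟩
        · exact P.gen_mul j hσ
        · exact P.sq_mul s hσ
      | zero => intro σ _; rw [zero_mul]; exact P.zero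
      | one => intro σ h; rwa [one_mul]
      | add x y _ _ hx hy => intro σ h; rw [add_mul]; exact P.add (hx σ h) (hy σ h)
      | mul x y _ _ hx hy => intro σ h; rw [mul_assoc]; exact hx _ (hy σ h)
    have h1 : InPreordering g (1 : MvPolynomial ι ℝ) := by
      simpa using P.single (g := g) ∅ IsSOS.one'
    simpa using key 1 h1
  · rintro ⟨c, h1, rfl⟩
    exact sum_mem fun J _ => mul_mem (preo_sos (h1 J)) (prod_mem fun j _ => preo_gen j)

end Pre

theorem polyIVT_real : Polynomial.CP.PolyIVT ℝ := by
  intro p a b hab h1 h2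
  obtain ⟨c, hc, e⟩ := intermediate_value_Icc hab p.continuousOn ⟨h1, h2⟩
  exact ⟨c, hc.1, hc.2, e⟩

/-- A Positivstellensatz: an empty basic closed semialgebraic set has an inconsistency
certificate. -/
theorem psatz {n : ℕ} (P : Subsemiring (MvPolynomial (Fin n) ℝ)) (hsq : ∀ a, a * a ∈ P)
    (G : Finset (MvPolynomial (Fin n) ℝ)) (hG : ∀ g ∈ G, g ∈ P)
    (hempty : ∀ x : Fin n → ℝ, ¬ ∀ g ∈ G, 0 ≤ eval x g) : -1 ∈ P := by
  by_contra h1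
  obtain ⟨S, _, _, _, φ, hφ, hS⟩ := Polynomial.CP.real_closed_ext P hsq h1
  have hpos : ∀ r : ℝ, 0 ≤ r → 0 ≤ φ (C r) := by
    intro r hr
    rw [← Real.mul_self_sqrt hr, C_mul, map_mul]
    exact mul_self_nonneg _
  have hpos' : ∀ r : ℝ, 0 < r → 0 < φ (C r) := by
    intro r hr
    refine lt_of_le_of_ne (hpos r hr.le) fun h => ?_
    have : φ (C r) * φ (C r⁻¹) = 1 := by
      rw [← map_mul, ← C_mul, mul_inv_cancel₀ hr.ne', C_1, map_one]
    rw [← h, zero_mul] at this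
    exact zero_ne_one this
  obtain ⟨x', hx'⟩ := Polynomial.CP.transfer hS polyIVT_real (φ.comp C) (RingHom.id ℝ) (by
    intro r
    rcases lt_trichotomy r 0 with h | h | h
    · have := hpos' (-r) (by linarith)
      rw [C_neg, map_neg] at this
      rw [sign_neg (by rw [RingHom.comp_apply]; linarith), RingHom.id_apply, sign_neg h]
    · subst h; simp
    · rw [sign_pos (by rw [RingHom.comp_apply]; exact hpos' r h), RingHom.id_apply, sign_pos h]) n G
      (fun i => φ (X i))
  apply hempty x'
  intro g hg
  have e1 : eval₂Hom (φ.comp C) (fun i => φ (X i)) = φ := by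
    apply MvPolynomial.ringHom_ext
    · intro r; simp
    · intro i; simp
  have h2 := hx' g hg
  rw [e1] at h2
  have h3 := sign_nonneg_iff.mpr (hφ g (hG g hg))
  rw [h2] at h3
  exact sign_nonneg_iff.mp h3

end CPM
end

section
open MvPolynomial
namespace CPM
set_option linter.unusedSectionVars false

/-- Squared norm polynomial. -/
noncomputable def nsq (σ : Type*) [Fintype σ] : MvPolynomial σ ℝ := ∑ v, X v ^ 2

theorem arch_of_ball {σ : Type*} [Fintype σ] (T : Subsemiring (MvPolynomial σ ℝ))
    (hsq : ∀ a, a * a ∈ T) (hC : ∀ r : ℝ, 0 ≤ r → C r ∈ T) (N : ℝ) (hN : C N - nsq σ ∈ T)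
    (i : σ) : ∃ M : ℝ, C M - X i ∈ T ∧ C M + X i ∈ T := by
  classical
  have h1 : C N - X i ^ 2 ∈ T := by
    have h2 : ∑ v ∈ Finset.univ.erase i, (X v : MvPolynomial σ ℝ) ^ 2 ∈ T :=
      sum_mem fun v _ => by rw [sq]; exact hsq _
    convert T.add_mem hN h2 using 1
    rw [nsq, ← Finset.add_sum_erase _ _ (Finset.mem_univ i)]; ring
  have e : (C (2⁻¹ : ℝ) : MvPolynomial σ ℝ) * 2 = 1 := by
    rw [← map_ofNat C 2, ← C_mul]; norm_num
  have e3 : (C (2⁻¹ * (N + 1)) : MvPolynomial σ ℝ) = C 2⁻¹ * (C N + 1) := by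
    rw [C_mul, C_add, C_1]
  refine ⟨2⁻¹ * (N + 1), ?_, ?_⟩
  · convert T.mul_mem (hC 2⁻¹ (by norm_num)) (T.add_mem (hsq (1 - X i)) h1) using 1
    rw [e3]
    linear_combination (X i) * e
  · convert T.mul_mem (hC 2⁻¹ (by norm_num)) (T.add_mem (hsq (1 + X i)) h1) using 1
    rw [e3]
    linear_combination (-X i) * e

/-- The semiring of sums of squares. -/
def sosR (σ : Type*) : Subsemiring (MvPolynomial σ ℝ) where
  carrier := {p | IsSOS p}
  mul_mem' := IsSOS.mul'
  add_mem' := IsSOS.add'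
  one_mem' := IsSOS.one'
  zero_mem' := IsSOS.zero'

theorem sosR_sq {σ : Type*} (a : MvPolynomial σ ℝ) : a * a ∈ sosR σ := by
  rw [← sq]; exact IsSOS.sq' a

/-- The preordering generated by the ball polynomial. -/
noncomputable def ballS (σ : Type*) [Fintype σ] (N : ℝ) : Subsemiring (MvPolynomial σ ℝ) :=
  Polynomial.CP.adjoinElt (sosR σ) sosR_sq (C N - nsq σ)

section
variable {σ : Type*} [Fintype σ] {N : ℝ}

theorem mem_ballS {f : MvPolynomial σ ℝ} :
    f ∈ ballS σ N ↔ ∃ s, IsSOS s ∧ ∃ t, IsSOS t ∧ f = s + t * (C N - nsq σ) := Iff.rfl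

theorem ballS_sos {f : MvPolynomial σ ℝ} (h : IsSOS f) : f ∈ ballS σ N :=
  mem_ballS.mpr ⟨f, h, 0, IsSOS.zero', by ring⟩

theorem ballS_gen : C N - nsq σ ∈ ballS σ N :=
  mem_ballS.mpr ⟨0, IsSOS.zero', 1, IsSOS.one', by ring⟩

theorem ballS_gens (i : σ) : ∃ M : ℝ, C M - X i ∈ ballS σ N ∧ C M + X i ∈ ballS σ N :=
  arch_of_ball _ (fun a => ballS_sos (sosR_sq a)) (fun _ hr => ballS_sos (IsSOS.const hr)) N
    ballS_gen i

theorem ballS_arch (a : MvPolynomial σ ℝ) : ∃ M : ℝ, C M - a ∈ ballS σ N :=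
  arch_of_gen _ (fun _ hr => ballS_sos (IsSOS.const hr)) ballS_gens a

theorem eval_nsq (x : σ → ℝ) : eval x (nsq σ) = ∑ i, x i ^ 2 := by
  simp [nsq]

theorem ballS_of_pos {f : MvPolynomial σ ℝ}
    (hf : ∀ x : σ → ℝ, ∑ i, x i ^ 2 ≤ N → 0 < eval x f) : f ∈ ballS σ N := by
  refine krivine_mv _ (fun _ hr => ballS_sos (IsSOS.const hr)) ballS_gens f ?_
  intro x hx
  apply hf
  have := hx _ ballS_gen
  rw [map_sub, eval_C, eval_nsq] at this
  linarith
end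

theorem ballS_to_pre {σ κ : Type*} [Fintype σ] [Fintype κ] [DecidableEq κ] {N : ℝ}
    {g : κ → MvPolynomial σ ℝ} (hg : C N - nsq σ ∈ preo g) {f : MvPolynomial σ ℝ}
    (hf : f ∈ ballS σ N) : f ∈ preo g := by
  obtain ⟨s, hs, t, ht, rfl⟩ := mem_ballS.mp hf
  exact add_mem (preo_sos hs) (mul_mem (preo_sos ht) hg)

theorem ballS_to_Q {σ κ : Type*} [Fintype σ] [Fintype κ] {N : ℝ}
    {h : κ → MvPolynomial σ ℝ} (hg : InQuadraticModule h (C N - nsq σ)) {f : MvPolynomial σ ℝ}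
    (hf : f ∈ ballS σ N) : InQuadraticModule h f := by
  obtain ⟨s, hs, t, ht, rfl⟩ := mem_ballS.mp hf
  exact Q.add (Q.of_sos hs) (Q.sos_mul ht hg)

/-- Wörmann: compactness gives an archimedean certificate. -/
theorem wormann {n a : ℕ} (g : Fin a → MvPolynomial (Fin n) ℝ)
    (hK : IsCompact {x : Fin n → ℝ | ∀ j, 0 ≤ eval x (g j)}) :
    ∃ R : ℝ, C R - nsq (Fin n) ∈ preo g := by
  classical
  obtain ⟨N, hN0, hN⟩ : ∃ N : ℝ, 0 < N ∧ ∀ x : Fin n → ℝ, (∀ j, 0 ≤ eval x (g j)) →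
      ∑ i, x i ^ 2 < N := by
    have hc : Continuous fun x : Fin n → ℝ => ∑ i, x i ^ 2 := by fun_prop
    obtain ⟨M, hM⟩ := (hK.image hc).bddAbove
    refine ⟨max M 0 + 1, by positivity, fun x hx => ?_⟩
    have := hM ⟨x, hx, rfl⟩
    have h2 := le_max_left M 0
    simp only at this
    linarith
  have hsq : ∀ a, a * a ∈ preo g := fun a => by rw [← sq]; exact preo_sq a
  have hm1 := psatz (Polynomial.CP.adjoinElt (preo g) hsq (nsq (Fin n) - C N))
    (fun a => ⟨_, hsq a, 0, zero_mem _, by ring⟩)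
    (insert (nsq (Fin n) - C N) (Finset.univ.image g)) (by
      intro q hq
      rw [Finset.mem_insert] at hq
      rcases hq with rfl | hq
      · exact ⟨0, zero_mem _, 1, one_mem _, by ring⟩
      · obtain ⟨j, -, rfl⟩ := Finset.mem_image.mp hq
        exact ⟨_, preo_gen j, 0, zero_mem _, by ring⟩) (by
      intro x hx
      have h1 := hN x fun j => hx _ (by simp)
      have h2 := hx _ (Finset.mem_insert_self _ _)
      rw [map_sub, eval_C, eval_nsq] at h2
      linarith)
  obtain ⟨q, hq, p, hp, e⟩ := hm1
  set r := nsq (Fin n) with hr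
  have hrP : r ∈ preo g := sum_mem fun v _ => preo_sq _
  have h1 : (1 + q) * (C N - r) ∈ preo g := by
    convert mul_mem hp (hsq (C N - r)) using 1
    linear_combination (r - C N) * e
  obtain ⟨k, hk⟩ := ballS_arch (N := N) q
  obtain ⟨s, hs, t, ht, e2⟩ := mem_ballS.mp hk
  have h2 : (1 + q) * (C k - q) ∈ preo g := by
    rw [e2]
    convert add_mem (mul_mem (preo_sos hs) (add_mem (one_mem _) hq)) (mul_mem (preo_sos ht) h1)
      using 1
    ring
  have ek : (C k : MvPolynomial (Fin n) ℝ) = C (k / 2) * 2 := by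
    rw [← map_ofNat C 2, ← C_mul]; norm_num
  have h3 : C (k + (k / 2) ^ 2) - q ∈ preo g := by
    convert add_mem h2 (preo_sq (g := g) (q - C (k / 2))) using 1
    rw [C_add, C_pow, ek]
    ring
  refine ⟨N * (1 + (k + (k / 2) ^ 2)), ?_⟩
  convert add_mem (add_mem h1 (mul_mem hq hrP)) (mul_mem (preo_const hN0.le) h3) using 1
  rw [C_mul, C_add, C_1]
  ring

end CPM
end

section
open MvPolynomial
namespace CPM
set_option linter.unusedSectionVars false

/-- Closed Euclidean ball (squared radius `N`). -/
def Bal (σ : Type*) [Fintype σ] (N : ℝ) : Set (σ → ℝ) := {x | ∑ i, x i ^ 2 ≤ N}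

theorem Bal_compact (σ : Type*) [Fintype σ] (N : ℝ) : IsCompact (Bal σ N) := by
  apply Metric.isCompact_of_isClosed_isBounded
  · exact isClosed_le (by fun_prop) continuous_const
  · apply (Metric.isBounded_closedBall (x := (0 : σ → ℝ)) (r := |N| + 1)).subset
    intro x hx
    rw [mem_closedBall_zero_iff, pi_norm_le_iff_of_nonneg (by positivity)]
    intro i
    have h1 : x i ^ 2 ≤ N := (Finset.single_le_sum (f := fun i => x i ^ 2)
      (fun j _ => sq_nonneg _) (Finset.mem_univ i)).trans hx
    rw [Real.norm_eq_abs]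
    have h2 : |x i| ^ 2 ≤ |N| := by rw [sq_abs]; exact h1.trans (le_abs_self N)
    nlinarith [abs_nonneg (x i), abs_nonneg N, sq_nonneg (|x i| - 1)]

theorem stone_weierstrass {σ : Type*} [Fintype σ] {B : Set (σ → ℝ)} (hB : IsCompact B)
    (G : (σ → ℝ) → ℝ) (hG : Continuous G) {ε : ℝ} (hε : 0 < ε) :
    ∃ q : MvPolynomial σ ℝ, ∀ y ∈ B, |eval y q - G y| < ε := by
  let co : σ → C(σ → ℝ, ℝ) := fun i => ⟨fun y => y i, continuous_apply i⟩
  let Φ : MvPolynomial σ ℝ →ₐ[ℝ] C(σ → ℝ, ℝ) := aeval co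
  have hΦ : ∀ (q : MvPolynomial σ ℝ) (y : σ → ℝ), Φ q y = eval y q := by
    intro q y
    have : ((ContinuousMap.evalAlgHom ℝ ℝ y : C(σ → ℝ, ℝ) →ₐ[ℝ] ℝ).comp Φ) =
        aeval y := by
      apply MvPolynomial.algHom_ext
      intro i
      simp [Φ, co]
    have := congrArg (fun h => h q) this
    simpa [aeval_eq_eval] using this
  have hsep : Φ.range.SeparatesPoints := by
    intro x y hxy
    obtain ⟨i, hi⟩ := Function.ne_iff.mp hxy
    refine ⟨Φ (X i), ⟨Φ (X i), ⟨X i, rfl⟩, rfl⟩, ?_⟩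
    rw [hΦ, hΦ, eval_X, eval_X]; exact hi
  obtain ⟨g, ⟨q, rfl⟩, hq⟩ :=
    ContinuousMap.exists_mem_subalgebra_near_continuous_of_isCompact_of_separatesPoints hsep
      ⟨G, hG⟩ hB hε
  refine ⟨q, fun y hy => ?_⟩
  have := hq y hy
  rw [← hΦ]
  exact this

theorem pow_bound (t : ℝ) (h0 : 0 ≤ t) (h1 : t ≤ 1) (k : ℕ) (hk : 0 < k) :
    t * (1 - t) ^ k ≤ 1 / k := by
  have hk' : (0 : ℝ) < k := by exact_mod_cast hk
  have h2 : (1 + k * t : ℝ) ≤ (1 + t) ^ k := one_add_mul_le_pow (by linarith) k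
  have h3 : (1 - t) ^ k * (1 + t) ^ k ≤ 1 := by
    rw [← mul_pow]; apply pow_le_one₀ <;> nlinarith
  have h4 : 0 ≤ (1 - t) ^ k := pow_nonneg (by linarith) k
  have h5 : (1 - t) ^ k * (1 + k * t) ≤ 1 := (mul_le_mul_of_nonneg_left h2 h4).trans h3
  rw [le_div_iff₀ hk']
  nlinarith

section Averkov
variable {E : Type*} [TopologicalSpace E]

theorem exists_penalty {S : Set E} (hS : IsCompact S) (F v : E → ℝ) (hF : Continuous F)
    (hv : Continuous v) (hv0 : ∀ x, 0 ≤ v x) (h : ∀ x ∈ S, v x = 0 → 0 < F x) :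
    ∃ c : ℝ, 0 ≤ c ∧ ∃ δ > 0, ∀ x ∈ S, δ ≤ F x + c * v x := by
  have h1 : ∃ c : ℝ, 0 ≤ c ∧ ∀ x ∈ S, 0 < F x + c * v x := by
    have hS1 : IsCompact (S ∩ {x | F x ≤ 0}) := hS.inter_right (isClosed_le hF continuous_const)
    rcases (S ∩ {x | F x ≤ 0}).eq_empty_or_nonempty with he | hne
    · refine ⟨0, le_rfl, fun x hx => ?_⟩
      by_contra hc
      have : x ∈ S ∩ {x | F x ≤ 0} := ⟨hx, by simpa using hc⟩
      rw [he] at this; exact this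
    · obtain ⟨x₀, hx₀, hm⟩ := hS1.exists_isMinOn hne hv.continuousOn
      obtain ⟨x₁, hx₁, hm'⟩ := hS1.exists_isMinOn hne hF.continuousOn
      have hpos : 0 < v x₀ := lt_of_le_of_ne (hv0 _) fun e =>
        absurd (h x₀ hx₀.1 e.symm) (not_lt.mpr hx₀.2)
      have hF1 : F x₁ ≤ 0 := hx₁.2
      refine ⟨-F x₁ / v x₀ + 1, by have := div_nonneg (neg_nonneg.mpr hF1) hpos.le; linarith,
        fun x hx => ?_⟩
      have hc0 := div_nonneg (neg_nonneg.mpr hF1) hpos.le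
      by_cases hFx : F x ≤ 0
      · have a1 : v x₀ ≤ v x := hm ⟨hx, hFx⟩
        have a2 : F x₁ ≤ F x := hm' ⟨hx, hFx⟩
        have a3 : -F x₁ / v x₀ * v x₀ = -F x₁ := div_mul_cancel₀ _ hpos.ne'
        nlinarith [mul_le_mul_of_nonneg_left a1 hc0]
      · push Not at hFx
        nlinarith [hv0 x, mul_nonneg hc0 (hv0 x)]
  obtain ⟨c, hc, h2⟩ := h1
  refine ⟨c, hc, ?_⟩
  rcases S.eq_empty_or_nonempty with he | hne
  · exact ⟨1, one_pos, fun x hx => by rw [he] at hx; exact hx.elim⟩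
  · obtain ⟨x₀, hx₀, hm⟩ := hS.exists_isMinOn hne
      (f := fun x => F x + c * v x) (by fun_prop)
    exact ⟨_, h2 x₀ hx₀, fun x hx => hm hx⟩

theorem averkov {J : Type*} [Fintype J] {S : Set E} (hS : IsCompact S) (F : E → ℝ)
    (u : J → E → ℝ) (hF : Continuous F) (hu : ∀ j, Continuous (u j))
    (h : ∀ x ∈ S, (∀ j, 0 ≤ u j x) → 0 < F x) :
    ∃ (c γ : ℝ) (k : ℕ), 0 ≤ c ∧
      ∀ x ∈ S, 0 < F x - ∑ j, c * ((1 - γ * u j x) ^ k) ^ 2 * u j x := by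
  obtain ⟨c, hc, δ, hδ, hcd⟩ := exists_penalty hS F (fun x => ∑ j, max (-u j x) 0) hF
    (by fun_prop) (fun x => Finset.sum_nonneg fun j _ => le_max_right _ _) (by
      intro x hx e
      apply h x hx
      intro j
      have := (Finset.sum_eq_zero_iff_of_nonneg (fun j _ => le_max_right (-u j x) 0)).mp e j
        (Finset.mem_univ j)
      have h2 := le_max_left (-u j x) 0
      linarith)
  obtain ⟨Γ, hΓ0, hΓ⟩ : ∃ Γ : ℝ, 0 < Γ ∧ ∀ x ∈ S, ∀ j, |u j x| ≤ Γ := by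
    obtain ⟨M, hM⟩ := (hS.image (f := fun x => ∑ j, |u j x|) (by fun_prop)).bddAbove
    refine ⟨max M 1, by positivity, fun x hx j => ?_⟩
    have h1 := hM ⟨x, hx, rfl⟩
    have h2 : |u j x| ≤ ∑ j, |u j x| := Finset.single_le_sum (f := fun j => |u j x|)
      (fun j _ => abs_nonneg _) (Finset.mem_univ j)
    exact h2.trans (h1.trans (le_max_left _ _))
  obtain ⟨k, hk⟩ := exists_nat_gt (Fintype.card J * (c * Γ) / δ)
  have hk0 : (0 : ℝ) < k := lt_of_le_of_lt (by positivity) hk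
  have hk0' : 0 < k := by exact_mod_cast hk0
  refine ⟨c, Γ⁻¹, k, hc, fun x hx => ?_⟩
  have hj : ∀ j, c * ((1 - Γ⁻¹ * u j x) ^ k) ^ 2 * u j x ≤ c * Γ / k - c * max (-u j x) 0 := by
    intro j
    have hb := abs_le.mp (hΓ x hx j)
    rcases le_total 0 (u j x) with h0 | h0
    · rw [max_eq_right (by linarith)]
      have t0 : 0 ≤ Γ⁻¹ * u j x := by positivity
      have t1 : Γ⁻¹ * u j x ≤ 1 := by
        rw [inv_mul_le_iff₀ hΓ0]; linarith
      have := pow_bound _ t0 t1 k hk0'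
      have h4 : 0 ≤ (1 - Γ⁻¹ * u j x) ^ k := pow_nonneg (by linarith) k
      have h5 : (1 - Γ⁻¹ * u j x) ^ k ≤ 1 := pow_le_one₀ (by linarith) (by linarith)
      have h6 : Γ⁻¹ * u j x * ((1 - Γ⁻¹ * u j x) ^ k) ^ 2 ≤ 1 / k := by
        refine le_trans ?_ this
        apply mul_le_mul_of_nonneg_left _ t0
        nlinarith
      have h7 : u j x = Γ * (Γ⁻¹ * u j x) := by rw [mul_inv_cancel_left₀ hΓ0.ne']
      have h8 : c * ((1 - Γ⁻¹ * u j x) ^ k) ^ 2 * u j x =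
          c * Γ * (Γ⁻¹ * u j x * ((1 - Γ⁻¹ * u j x) ^ k) ^ 2) := by
        field_simp
      rw [h8]
      have := mul_le_mul_of_nonneg_left h6 (by positivity : 0 ≤ c * Γ)
      rw [mul_one_div] at this
      linarith
    · rw [max_eq_left (by linarith)]
      have t0 : Γ⁻¹ * u j x ≤ 0 := mul_nonpos_of_nonneg_of_nonpos (by positivity) h0
      have h4 : 1 ≤ ((1 - Γ⁻¹ * u j x) ^ k) ^ 2 :=
        one_le_pow₀ (one_le_pow₀ (by linarith))
      have h5 : 0 ≤ c * Γ / k := by positivity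
      have h6 : c * u j x * ((1 - Γ⁻¹ * u j x) ^ k) ^ 2 ≤ c * u j x := by
        nlinarith [mul_nonneg (neg_nonneg.mpr (mul_nonpos_of_nonneg_of_nonpos hc h0))
          (sub_nonneg.mpr h4)]
      nlinarith
  have hsum := Finset.sum_le_sum fun j (_ : j ∈ Finset.univ) => hj j
  rw [Finset.sum_sub_distrib, ← Finset.mul_sum, Finset.sum_const, Finset.card_univ,
    nsmul_eq_mul] at hsum
  have h2 := hcd x hx
  have h3 : Fintype.card J * (c * Γ / k) < δ := by
    rw [← mul_div_assoc, div_lt_iff₀ hk0]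
    rw [div_lt_iff₀ hδ] at hk
    linarith
  linarith
end Averkov

end CPM
end

section
open MvPolynomial
namespace CPM
set_option linter.unusedSectionVars false

theorem exists_lower {E : Type*} [TopologicalSpace E] {S : Set E} (hS : IsCompact S) (F : E → ℝ)
    (hF : Continuous F) (h : ∀ x ∈ S, 0 < F x) : ∃ δ > 0, ∀ x ∈ S, δ ≤ F x := by
  obtain ⟨c, -, δ, hδ, h1⟩ := exists_penalty hS F (fun _ => 0) hF continuous_const
    (fun _ => le_rfl) (fun x hx _ => h x hx)
  exact ⟨δ, hδ, fun x hx => by simpa using h1 x hx⟩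

theorem continuous_eval_comp {E σ : Type*} [TopologicalSpace E] (f : MvPolynomial σ ℝ)
    (φ : E → σ → ℝ) (hφ : Continuous φ) : Continuous fun e => eval (φ e) f :=
  (MvPolynomial.continuous_eval f).comp hφ

theorem continuous_elim {E α β : Type*} [TopologicalSpace E] {φ : E → α → ℝ} {ψ : E → β → ℝ}
    (h1 : Continuous φ) (h2 : Continuous ψ) : Continuous fun e => Sum.elim (φ e) (ψ e) := by
  refine continuous_pi fun i => ?_
  rcases i with i | i
  · exact (continuous_apply i).comp h1
  · exact (continuous_apply i).comp h2

theorem Bal_inl {α β : Type*} [Fintype α] [Fintype β] {N : ℝ} {w : α ⊕ β → ℝ}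
    (hw : w ∈ Bal (α ⊕ β) N) : (w ∘ Sum.inl) ∈ Bal α N := by
  have h1 : ∑ i, w i ^ 2 ≤ N := hw
  rw [Fintype.sum_sum_type] at h1
  have : 0 ≤ ∑ i, w (Sum.inr i) ^ 2 := Finset.sum_nonneg fun i _ => sq_nonneg _
  show ∑ i, w (Sum.inl i) ^ 2 ≤ N
  linarith

theorem splitting {α β γ : Type*} [Fintype α] [Fintype β] [Fintype γ] {R N : ℝ} (hR : 0 ≤ R)
    (f₁ : MvPolynomial (α ⊕ β) ℝ) (f₂ : MvPolynomial (β ⊕ γ) ℝ)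
    (hp : ∀ x ∈ Bal α R, ∀ w ∈ Bal (β ⊕ γ) N,
      0 < eval (Sum.elim x (w ∘ Sum.inl)) f₁ + eval w f₂) :
    ∃ q : MvPolynomial β ℝ,
      (∀ x ∈ Bal α R, ∀ y ∈ Bal β N, 0 < eval (Sum.elim x y) f₁ - eval y q) ∧
      (∀ w ∈ Bal (β ⊕ γ) N, 0 < eval w f₂ + eval (w ∘ Sum.inl) q) := by
  have hcl : Continuous fun w : β ⊕ γ → ℝ => w ∘ Sum.inl :=
    continuous_pi fun i => continuous_apply _
  obtain ⟨ε, hε, hm⟩ := exists_lower ((Bal_compact α R).prod (Bal_compact (β ⊕ γ) N))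
    (fun e => eval (Sum.elim e.1 (e.2 ∘ Sum.inl)) f₁ + eval e.2 f₂)
    ((continuous_eval_comp f₁ _ (continuous_elim continuous_fst (hcl.comp continuous_snd))).add
      (continuous_eval_comp f₂ _ continuous_snd))
    (fun e he => hp _ he.1 _ he.2)
  have hne : (Bal α R).Nonempty := ⟨0, by simpa [Bal] using hR⟩
  have hc : ∀ y : β → ℝ, Continuous fun x : α → ℝ => eval (Sum.elim x y) f₁ := fun y =>
    continuous_eval_comp f₁ _ (continuous_elim continuous_id continuous_const)
  let G : (β → ℝ) → ℝ := fun y => sInf ((fun x : α → ℝ => eval (Sum.elim x y) f₁) '' Bal α R)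
  have hG : Continuous G := by
    apply IsCompact.continuous_sInf (Bal_compact α R)
      (f := fun (y : β → ℝ) (x : α → ℝ) => eval (Sum.elim x y) f₁)
    exact continuous_eval_comp f₁ (fun e : (β → ℝ) × (α → ℝ) => Sum.elim e.2 e.1)
      (continuous_elim continuous_snd continuous_fst)
  obtain ⟨q, hq⟩ := stone_weierstrass (Bal_compact β N) (fun y => G y - ε / 2)
    (hG.sub continuous_const) (by positivity : 0 < ε / 4)
  refine ⟨q, fun x hx y hy => ?_, fun w hw => ?_⟩
  · have h1 := abs_lt.mp (hq y hy)
    have h2 : G y ≤ eval (Sum.elim x y) f₁ :=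
      csInf_le ((Bal_compact α R).image (hc y)).bddBelow ⟨x, hx, rfl⟩
    linarith [h1.2]
  · have h1 := abs_lt.mp (hq _ (Bal_inl hw))
    obtain ⟨x, hx, e⟩ := ((Bal_compact α R).image (hc (w ∘ Sum.inl))).sInf_mem (hne.image _)
    have h2 := hm (x, w) ⟨hx, hw⟩
    have e' : eval (Sum.elim x (w ∘ Sum.inl)) f₁ = G (w ∘ Sum.inl) := e
    simp only at h2
    linarith [h1.1]

theorem sqrt_approx {σ : Type*} [Fintype σ] {N : ℝ} (A : MvPolynomial σ ℝ)
    (hA : ∀ x ∈ Bal σ N, 0 ≤ eval x A) :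
    ∃ M : ℝ, 0 ≤ M ∧ ∀ t : ℝ, 0 < t → t ≤ 1 → ∃ a : MvPolynomial σ ℝ, ∀ x ∈ Bal σ N,
      |eval x A - eval x a ^ 2| ≤ t ^ 2 ∧ eval x a ^ 2 ≤ M := by
  have hAc : Continuous fun x => eval x A := MvPolynomial.continuous_eval A
  obtain ⟨M₁, hM₁⟩ := ((Bal_compact σ N).image hAc).bddAbove
  set M₀ := max M₁ 0 with hM0
  have hM : ∀ x ∈ Bal σ N, eval x A ≤ M₀ := fun x hx =>
    (hM₁ ⟨x, hx, rfl⟩).trans (le_max_left _ _)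
  have h00 : 0 ≤ M₀ := le_max_right _ _
  refine ⟨M₀ + 1, by linarith, fun t ht ht1 => ?_⟩
  set L := √M₀
  have hL : 0 ≤ L := Real.sqrt_nonneg _
  have hδ : 0 < t ^ 2 / (2 * L + 1) := by positivity
  set δ := t ^ 2 / (2 * L + 1) with hδd
  have hδe : δ * (2 * L + 1) = t ^ 2 := div_mul_cancel₀ _ (by positivity)
  have ht2 : t ^ 2 ≤ 1 := pow_le_one₀ ht.le ht1
  have hδ1 : δ ≤ 1 := by nlinarith [mul_nonneg hδ.le hL]
  obtain ⟨a, ha⟩ := stone_weierstrass (Bal_compact σ N) (fun x => √(eval x A))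
    (Real.continuous_sqrt.comp hAc) hδ
  refine ⟨a, fun x hx => ?_⟩
  have h1 := ha x hx
  have hs0 := Real.sqrt_nonneg (eval x A)
  have hsL : √(eval x A) ≤ L := Real.sqrt_le_sqrt (hM x hx)
  have hs2 := Real.sq_sqrt (hA x hx)
  set s := √(eval x A)
  set v := eval x a
  have h3 : |eval x A - v ^ 2| ≤ t ^ 2 := by
    rw [← hs2, ← hδe, show s ^ 2 - v ^ 2 = -((v - s) * (v - s + 2 * s)) by ring, abs_neg, abs_mul]
    apply mul_le_mul h1.le _ (abs_nonneg _) hδ.le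
    refine (abs_add_le _ _).trans ?_
    rw [abs_of_nonneg (by positivity : 0 ≤ 2 * s)]
    linarith
  refine ⟨h3, ?_⟩
  have := (abs_le.mp h3).1
  linarith [hM x hx]

section Dec
variable {α β : Type*} [Fintype α] [Fintype β] {R N : ℝ}

/-- Polynomials with a separated decomposition. -/
def Dec (α β : Type*) [Fintype α] [Fintype β] (R N : ℝ) :
    AddSubmonoid (MvPolynomial (α ⊕ β) ℝ) where
  carrier := {f | ∃ k a b, IsSOS k ∧ a ∈ ballS α R ∧ b ∈ ballS β N ∧
    f = k + rename Sum.inl a + rename Sum.inr b}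
  zero_mem' := ⟨0, 0, 0, IsSOS.zero', zero_mem _, zero_mem _, by simp⟩
  add_mem' := by
    rintro _ _ ⟨k, a, b, hk, ha, hb, rfl⟩ ⟨k', a', b', hk', ha', hb', rfl⟩
    exact ⟨k + k', a + a', b + b', IsSOS.add' hk hk', add_mem ha ha', add_mem hb hb', by
      rw [map_add, map_add]; ring⟩

theorem ballS_nonneg {σ : Type*} [Fintype σ] {N : ℝ} {A : MvPolynomial σ ℝ} (hA : A ∈ ballS σ N)
    (x : σ → ℝ) (hx : x ∈ Bal σ N) : 0 ≤ eval x A := by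
  have hsos : ∀ s : MvPolynomial σ ℝ, IsSOS s → 0 ≤ eval x s := by
    rintro _ ⟨k, s, rfl⟩
    rw [map_sum]
    exact Finset.sum_nonneg fun i _ => by rw [map_pow]; positivity
  obtain ⟨s, hs, t, ht, rfl⟩ := mem_ballS.mp hA
  rw [map_add, map_mul, map_sub, eval_C, eval_nsq]
  have : ∑ i, x i ^ 2 ≤ N := hx
  exact add_nonneg (hsos s hs) (mul_nonneg (hsos t ht) (by linarith))

theorem bracket_mem {σ : Type*} [Fintype σ] {N : ℝ} {A a : MvPolynomial σ ℝ} {M t ε : ℝ}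
    (ht : 0 < t) (ht1 : t ≤ 1) (hε : t ^ 2 * (M ^ 2 / 2 + 1) < ε / 2)
    (ha : ∀ x ∈ Bal σ N, |eval x A - eval x a ^ 2| ≤ t ^ 2 ∧ eval x a ^ 2 ≤ M) :
    C (ε / 2) - C (t ^ 2 / 2) * a ^ 4 - C ((t ^ 2)⁻¹ / 2) * (A - a ^ 2) ^ 2
      - C (1 / 2) * (A - a ^ 2) ^ 2 ∈ ballS σ N := by
  apply ballS_of_pos
  intro x hx
  obtain ⟨h1, h2⟩ := ha x hx
  simp only [map_sub, map_mul, map_pow, eval_C]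
  set r := eval x A - eval x a ^ 2
  set v := eval x a
  have hr2 : r ^ 2 ≤ (t ^ 2) ^ 2 := sq_le_sq.mpr (by rwa [abs_of_nonneg (by positivity : 0 ≤ t ^ 2)])
  have hT : 0 < t ^ 2 := by positivity
  have hT1 : t ^ 2 ≤ 1 := pow_le_one₀ ht.le ht1
  have h4 : v ^ 4 ≤ M ^ 2 := by
    have := pow_le_pow_left₀ (sq_nonneg v) h2 2
    calc v ^ 4 = (v ^ 2) ^ 2 := by ring
      _ ≤ _ := this
  have h5 : (t ^ 2)⁻¹ * r ^ 2 ≤ t ^ 2 := by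
    rw [inv_mul_le_iff₀ hT]; nlinarith
  have h6 : t ^ 2 * v ^ 4 ≤ t ^ 2 * M ^ 2 := mul_le_mul_of_nonneg_left h4 hT.le
  have h7 : r ^ 2 ≤ t ^ 2 := by nlinarith
  nlinarith

theorem prod_mem {A : MvPolynomial α ℝ} {B : MvPolynomial β ℝ} (hA : A ∈ ballS α R)
    (hB : B ∈ ballS β N) {ε : ℝ} (hε : 0 < ε) :
    rename Sum.inl A * rename Sum.inr B + C ε ∈ Dec α β R N := by
  obtain ⟨M₁, hM₁, h1⟩ := sqrt_approx A (ballS_nonneg hA)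
  obtain ⟨M₂, hM₂, h2⟩ := sqrt_approx B (ballS_nonneg hB)
  set D := M₁ ^ 2 / 2 + 1 + (M₂ ^ 2 / 2 + 1) with hD
  have hD0 : 0 < D := by positivity
  obtain ⟨t, ht, ht1, htD⟩ : ∃ t : ℝ, 0 < t ∧ t ≤ 1 ∧ t ^ 2 * D < ε / 2 := by
    refine ⟨min 1 (ε / (4 * D)), by positivity, min_le_left _ _, ?_⟩
    have a1 : min 1 (ε / (4 * D)) ≤ 1 := min_le_left _ _
    have a2 : min 1 (ε / (4 * D)) ≤ ε / (4 * D) := min_le_right _ _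
    have a0 : 0 < min 1 (ε / (4 * D)) := by positivity
    set t := min 1 (ε / (4 * D))
    have a3 : t ^ 2 ≤ ε / (4 * D) := by nlinarith
    calc t ^ 2 * D ≤ ε / (4 * D) * D := mul_le_mul_of_nonneg_right a3 hD0.le
      _ = ε / 4 := by field_simp
      _ < ε / 2 := by linarith
  obtain ⟨a, ha⟩ := h1 t ht ht1
  obtain ⟨b, hb⟩ := h2 t ht ht1
  have hT : 0 < t ^ 2 := by positivity
  have e1 := bracket_mem (ε := ε) ht ht1 (by nlinarith [sq_nonneg M₂]) ha
  have e2 := bracket_mem (ε := ε) ht ht1 (by nlinarith [sq_nonneg M₁]) hb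
  have half : (0 : ℝ) ≤ 1 / 2 := by norm_num
  set A' : MvPolynomial (α ⊕ β) ℝ := rename Sum.inl A
  set B' : MvPolynomial (α ⊕ β) ℝ := rename Sum.inr B
  set a' : MvPolynomial (α ⊕ β) ℝ := rename Sum.inl a with ha'
  set b' : MvPolynomial (α ⊕ β) ℝ := rename Sum.inr b with hb'
  refine ⟨(a' * b') ^ 2 + C (1 / 2) * (C t * a' ^ 2 + C t⁻¹ * (B' - b' ^ 2)) ^ 2
    + C (1 / 2) * (C t * b' ^ 2 + C t⁻¹ * (A' - a' ^ 2)) ^ 2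
    + C (1 / 2) * ((A' - a' ^ 2) + (B' - b' ^ 2)) ^ 2, _, _, ?_, e1, e2, ?_⟩
  · refine IsSOS.add' (IsSOS.add' (IsSOS.add' (IsSOS.sq' _) ?_) ?_) ?_ <;>
      exact IsSOS.mul' (IsSOS.const half) (IsSOS.sq' _)
  · have c1 : (C t * C t⁻¹ : MvPolynomial (α ⊕ β) ℝ) = 1 := by
      rw [← C_mul, mul_inv_cancel₀ ht.ne', C_1]
    have c2 : (C (1 / 2) * 2 : MvPolynomial (α ⊕ β) ℝ) = 1 := by
      rw [← map_ofNat C 2, ← C_mul]; norm_num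
    have c3 : (C (t ^ 2 / 2) : MvPolynomial (α ⊕ β) ℝ) = C t ^ 2 * C (1 / 2) := by
      rw [← C_pow, ← C_mul]; congr 1; ring
    have c4 : (C ((t ^ 2)⁻¹ / 2) : MvPolynomial (α ⊕ β) ℝ) = C t⁻¹ ^ 2 * C (1 / 2) := by
      rw [← C_pow, ← C_mul]; congr 1; rw [inv_pow]; ring
    have c5 : (C (ε / 2) : MvPolynomial (α ⊕ β) ℝ) = C ε * C (1 / 2) := by
      rw [← C_mul]; congr 1; ring
    simp only [map_sub, map_mul, map_pow, rename_C]
    rw [c3, c4, c5]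
    linear_combination
      (-(a' ^ 2 * (B' - b' ^ 2) + b' ^ 2 * (A' - a' ^ 2)) * C (1 / 2) * 2) * c1
      - (a' ^ 2 * (B' - b' ^ 2) + b' ^ 2 * (A' - a' ^ 2)
        + (A' - a' ^ 2) * (B' - b' ^ 2) + C ε) * c2

theorem pos_mem_Dec (f : MvPolynomial (α ⊕ β) ℝ)
    (hf : ∀ x ∈ Bal α R, ∀ y ∈ Bal β N, 0 < eval (Sum.elim x y) f) : f ∈ Dec α β R N := by
  obtain ⟨η, hη, hm⟩ := exists_lower ((Bal_compact α R).prod (Bal_compact β N))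
    (fun e => eval (Sum.elim e.1 e.2) f)
    (continuous_eval_comp f _ (continuous_elim continuous_fst continuous_snd))
    (fun e he => hf _ he.1 _ he.2)
  let Mo : Submonoid (MvPolynomial (α ⊕ β) ℝ) :=
    { carrier := {t | ∃ A ∈ ballS α R, ∃ B ∈ ballS β N, t = rename Sum.inl A * rename Sum.inr B}
      one_mem' := ⟨1, one_mem _, 1, one_mem _, by simp⟩
      mul_mem' := by
        rintro _ _ ⟨A, hA, B, hB, rfl⟩ ⟨A', hA', B', hB', rfl⟩
        exact ⟨A * A', mul_mem hA hA', B * B', mul_mem hB hB', by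
          rw [map_mul, map_mul]; ring⟩ }
  let T := Mo.subsemiringClosure
  have hTl : ∀ A ∈ ballS α R, rename Sum.inl A ∈ T := fun A hA =>
    AddSubmonoid.subset_closure ⟨A, hA, 1, one_mem _, by simp⟩
  have hTr : ∀ B ∈ ballS β N, rename Sum.inr B ∈ T := fun B hB =>
    AddSubmonoid.subset_closure ⟨1, one_mem _, B, hB, by simp⟩
  have hmem : f - C (η / 2) ∈ T := by
    apply krivine_mv
    · intro r hr
      have := hTl (C r) (ballS_sos (IsSOS.const hr))
      rwa [rename_C] at this
    · rintro (i | i)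
      · obtain ⟨M, h1, h2⟩ := ballS_gens (N := R) i
        refine ⟨M, ?_, ?_⟩
        · simpa using hTl _ h1
        · simpa using hTl _ h2
      · obtain ⟨M, h1, h2⟩ := ballS_gens (N := N) i
        refine ⟨M, ?_, ?_⟩
        · simpa using hTr _ h1
        · simpa using hTr _ h2
    · intro w hw
      have h1 := hw _ (hTl _ ballS_gen)
      have h2 := hw _ (hTr _ ballS_gen)
      rw [eval_rename, map_sub, eval_C, eval_nsq] at h1 h2
      have h3 := hm (w ∘ Sum.inl, w ∘ Sum.inr) 
        ⟨sub_nonneg.mp h1, sub_nonneg.mp h2⟩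
      simp only [Sum.elim_comp_inl_inr] at h3
      rw [map_sub, eval_C]
      linarith
  have key : ∀ t ∈ T, ∀ ε : ℝ, 0 < ε → t + C ε ∈ Dec α β R N := by
    intro t ht
    induction ht using AddSubmonoid.closure_induction with
    | mem t h =>
      obtain ⟨A, hA, B, hB, rfl⟩ := h
      exact fun ε hε => prod_mem hA hB hε
    | zero =>
      intro ε hε
      exact ⟨C ε, 0, 0, IsSOS.const hε.le, zero_mem _, zero_mem _, by simp⟩
    | add s t _ _ ihs iht =>
      intro ε hε
      convert add_mem (ihs (ε / 2) (by positivity)) (iht (ε / 2) (by positivity)) using 1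
      have : (C ε : MvPolynomial (α ⊕ β) ℝ) = C (ε / 2) + C (ε / 2) := by
        rw [← C_add]; congr 1; ring
      rw [this]; ring
  simpa using key _ hmem (η / 2) (by positivity)

end Dec
end CPM
end

section
open MvPolynomial
namespace CPM
set_option linter.unusedSectionVars false

theorem ballS_inl_Q {α β κ : Type*} [Fintype α] [Fintype β] [Fintype κ] {N : ℝ}
    {h : κ → MvPolynomial (α ⊕ β) ℝ} (hg : InQuadraticModule h (C N - nsq (α ⊕ β)))
    {f : MvPolynomial α ℝ} (hf : f ∈ ballS α N) :
    InQuadraticModule h (rename Sum.inl f) := by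
  have hren : ∀ s : MvPolynomial α ℝ, IsSOS s →
      IsSOS (rename Sum.inl s : MvPolynomial (α ⊕ β) ℝ) := by
    rintro _ ⟨k, s, rfl⟩
    exact ⟨k, fun i => rename Sum.inl (s i), by simp⟩
  obtain ⟨s, hs, t, ht, rfl⟩ := mem_ballS.mp hf
  rw [map_add, map_mul]
  refine Q.add (Q.of_sos (hren s hs)) (Q.sos_mul (hren t ht) ?_)
  have : (rename Sum.inl (C N - nsq α) : MvPolynomial (α ⊕ β) ℝ) =
      (C N - nsq (α ⊕ β)) + ∑ v : β, X (Sum.inr v) ^ 2 := by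
    simp only [nsq, map_sub, rename_C, map_sum, map_pow, rename_X, Fintype.sum_sum_type]
    ring
  rw [this]
  exact Q.add hg (Q.of_sos (IsSOS.sum' _ _ fun v _ => IsSOS.sq' _))

theorem main
    (n m p a b : ℕ)
    (g : Fin a → MvPolynomial (Fin n) ℝ)
    (h : Fin b → MvPolynomial (Fin m ⊕ Fin p) ℝ)
    (hKx : IsCompact {x : Fin n → ℝ | ∀ j, 0 ≤ eval x (g j)})
    (N : ℝ)
    (hN : InQuadraticModule h (C N - nsq (Fin m ⊕ Fin p)))
    (f₁ : MvPolynomial (Fin n ⊕ Fin m) ℝ) (f₂ : MvPolynomial (Fin m ⊕ Fin p) ℝ)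
    (hpos : ∀ (x : Fin n → ℝ) (w : Fin m ⊕ Fin p → ℝ), (∀ j, 0 ≤ eval x (g j)) →
      (∀ k, 0 ≤ eval w (h k)) → 0 < eval (Sum.elim x (w ∘ Sum.inl)) f₁ + eval w f₂) :
    ∃ (kp : MvPolynomial (Fin n ⊕ Fin m) ℝ) (σ : MvPolynomial (Fin n) ℝ)
      (ψ : MvPolynomial (Fin m ⊕ Fin p) ℝ),
      IsSOS kp ∧ InPreordering g σ ∧ InQuadraticModule h ψ ∧
      (rename (Sum.map id Sum.inl) f₁ + rename Sum.inr f₂ :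
        MvPolynomial (Fin n ⊕ Fin m ⊕ Fin p) ℝ) =
      rename (Sum.map id Sum.inl) kp + rename Sum.inl σ + rename Sum.inr ψ := by
  obtain ⟨R, hR0, hR⟩ : ∃ R : ℝ, 0 ≤ R ∧ C R - nsq (Fin n) ∈ preo g := by
    obtain ⟨R, hR⟩ := wormann g hKx
    refine ⟨max R 0, le_max_right _ _, ?_⟩
    convert add_mem hR (preo_const (g := g) (sub_nonneg.mpr (le_max_left R 0))) using 1
    rw [C_sub]; ring
  have hcl : Continuous fun w : Fin m ⊕ Fin p → ℝ => w ∘ Sum.inl :=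
    continuous_pi fun i => continuous_apply _
  obtain ⟨c, γ, k, hc, hav⟩ := averkov
    ((Bal_compact (Fin n) R).prod (Bal_compact (Fin m ⊕ Fin p) N))
    (fun e => eval (Sum.elim e.1 (e.2 ∘ Sum.inl)) f₁ + eval e.2 f₂)
    (fun (j : Fin a ⊕ Fin b) e =>
      Sum.elim (fun j => eval e.1 (g j)) (fun k => eval e.2 (h k)) j)
    ((continuous_eval_comp f₁ _ (continuous_elim continuous_fst (hcl.comp continuous_snd))).add
      (continuous_eval_comp f₂ _ continuous_snd))
    (by
      rintro (j | j)
      · exact continuous_eval_comp _ _ continuous_fst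
      · exact continuous_eval_comp _ _ continuous_snd)
    (fun e _ hu => hpos e.1 e.2 (fun j => hu (Sum.inl j)) (fun j => hu (Sum.inr j)))
  set sg : MvPolynomial (Fin n) ℝ := ∑ j, C c * ((1 - C γ * g j) ^ k) ^ 2 * g j with hsg
  set sh : MvPolynomial (Fin m ⊕ Fin p) ℝ := ∑ j, C c * ((1 - C γ * h j) ^ k) ^ 2 * h j with hsh
  have hsgP : sg ∈ preo g := sum_mem fun j _ =>
    mul_mem (mul_mem (preo_const hc) (preo_sq _)) (preo_gen j)
  have hshQ : InQuadraticModule h sh := Q.sum _ _ fun j _ =>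
    Q.sos_mul (IsSOS.mul' (IsSOS.const hc) (IsSOS.sq' _)) (Q.gen j)
  obtain ⟨q, hq1, hq2⟩ := splitting (N := N) hR0 (f₁ - rename Sum.inl sg) (f₂ - sh) (by
    intro x hx w hw
    have := hav (x, w) ⟨hx, hw⟩
    simp only [Fintype.sum_sum_type, Sum.elim_inl, Sum.elim_inr] at this
    rw [map_sub, map_sub, eval_rename, Sum.elim_comp_inl, hsg, hsh, map_sum, map_sum]
    simp only [map_mul, map_pow, map_sub, map_one, eval_C]
    linarith)
  obtain ⟨kp, A, B, hk, hA, hB, e⟩ := pos_mem_Dec (R := R) (N := N)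
    (f₁ - rename Sum.inl sg - rename Sum.inr q) (by
      intro x hx y hy
      rw [map_sub, eval_rename, Sum.elim_comp_inr]
      exact hq1 x hx y hy)
  have h2 : f₂ - sh + rename Sum.inl q ∈ ballS (Fin m ⊕ Fin p) N := by
    apply ballS_of_pos
    intro w hw
    rw [map_add, eval_rename]
    exact hq2 w hw
  refine ⟨kp, sg + A, sh + (f₂ - sh + rename Sum.inl q) + rename Sum.inl B, hk,
    preo_iff.mp (add_mem hsgP (ballS_to_pre hR hA)),
    Q.add (Q.add hshQ (ballS_to_Q hN h2)) (ballS_inl_Q hN hB), ?_⟩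
  have e1 : f₁ = kp + rename Sum.inl A + rename Sum.inr B + rename Sum.inl sg
      + rename Sum.inr q := by
    rw [← e]; ring
  have r1 : ∀ u : MvPolynomial (Fin n) ℝ, (rename (Sum.map id Sum.inl)
      (rename Sum.inl u : MvPolynomial (Fin n ⊕ Fin m) ℝ) :
        MvPolynomial (Fin n ⊕ Fin m ⊕ Fin p) ℝ) = rename Sum.inl u := by
    intro u; rw [rename_rename]; rfl
  have r2 : ∀ u : MvPolynomial (Fin m) ℝ, (rename (Sum.map id Sum.inl)
      (rename Sum.inr u : MvPolynomial (Fin n ⊕ Fin m) ℝ) :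
        MvPolynomial (Fin n ⊕ Fin m ⊕ Fin p) ℝ) =
      rename Sum.inr (rename Sum.inl u : MvPolynomial (Fin m ⊕ Fin p) ℝ) := by
    intro u; rw [rename_rename, rename_rename]; rfl
  rw [e1]
  simp only [map_add, map_sub, r1, r2]
  ring

end CPM
end

theorem cartesian_putinar_right
    (n m p a b : ℕ)
    (g : Fin a → MvPolynomial (Fin n) ℝ)
    (h : Fin b → MvPolynomial (Fin m ⊕ Fin p) ℝ)
    (Kx : Set (Fin n → ℝ))
    (Kyz : Set ((Fin m → ℝ) × (Fin p → ℝ)))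
    (K : Set ((Fin n → ℝ) × (Fin m → ℝ) × (Fin p → ℝ)))
    (hKx : Kx = {x | ∀ j, 0 ≤ eval x (g j)})
    (hKyz : Kyz = {w | ∀ k, 0 ≤ eval (Sum.elim w.1 w.2) (h k)})
    (hK : K = {w | w.1 ∈ Kx ∧ w.2 ∈ Kyz})
    (hKxCompact : IsCompact Kx) (hKyzCompact : IsCompact Kyz)
    (hKint : (interior K).Nonempty)
    (N : ℝ)
    (hN : InQuadraticModule h (C N - ∑ v : Fin m ⊕ Fin p, X v ^ 2))
    (f : MvPolynomial (Fin n ⊕ Fin m ⊕ Fin p) ℝ)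
    (f₁ : MvPolynomial (Fin n ⊕ Fin m) ℝ) (f₂ : MvPolynomial (Fin m ⊕ Fin p) ℝ)
    (hf : f = rename (Sum.map id Sum.inl) f₁ + rename Sum.inr f₂)
    (hpos : ∀ w ∈ K, 0 < eval (Sum.elim w.1 (Sum.elim w.2.1 w.2.2)) f) :
    ∃ (κpol : MvPolynomial (Fin n ⊕ Fin m) ℝ) (σ : MvPolynomial (Fin n) ℝ)
      (ψ : MvPolynomial (Fin m ⊕ Fin p) ℝ),
      IsSOS κpol ∧ InPreordering g σ ∧ InQuadraticModule h ψ ∧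
      f = rename (Sum.map id Sum.inl) κpol + rename Sum.inl σ + rename Sum.inr ψ := by
  subst hf
  refine CPM.main n m p a b g h (hKx ▸ hKxCompact) N hN f₁ f₂ ?_
  intro x w hx hw
  have h1 := hpos (x, w ∘ Sum.inl, w ∘ Sum.inr) (by
    rw [hK]
    refine ⟨by rw [hKx]; exact hx, ?_⟩
    rw [hKyz]
    intro k
    simpa only [Sum.elim_comp_inl_inr] using hw k)
  simp only [Sum.elim_comp_inl_inr, map_add, eval_rename] at h1
  have e : Sum.elim x (w ∘ Sum.inl) = Sum.elim x w ∘ Sum.map id Sum.inl := by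
    funext i
    rcases i with i | i <;> rfl
  rw [e]
  exact h1
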